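/- arXiv:1708.07597 — 2 statements merged into one kernel-verified Lean document; each statement's English description precedes it below -/
import Mathlib

section
/- Let q be an odd prime power with q ≡ 2 (mod 3), let k ≥ 3, and suppose g_i(X) = X^3 for every 3 ≤ i ≤ k. For w = (w_1,…,w_k) ∈ F_q^k, let T_w be the number of u ∈ F_q with f_3(u)w_3 + ⋯ + f_k(u)w_k = 0. Then for every w ∈ F_q^k, either λ_w = q(T_w − 1), or λ_w ≤ (q − T_w)·M_q; moreover M_q ≤ 2√q. -/
/-- `λ_w = Σ_{a ∈ F_q^*, u ∈ F_q} ζ_p^{Tr(a w_1 + a u w_2 + Σ_{i=3}^k g_i(a) f_i(u) w_i)}`,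
where `ζ_p = exp(2πi/p)` and `Tr : F_q → F_p` is the absolute trace. Coordinates are
indexed by `Fin k`, with index `0` playing the role of `1`, index `1` the role of `2`, and
indices `i` with `2 ≤ i` the roles of `3,…,k`. -/
noncomputable def lamW (p : ℕ) {k : ℕ} (F : Type) [Field F] [Fintype F] [DecidableEq F]
    [Algebra (ZMod p) F] (hk : 3 ≤ k) (f g : Fin k → Polynomial F) (w : Fin k → F) : ℂ :=
  ∑ a ∈ Finset.univ.filter (fun a : F => a ≠ 0), ∑ u : F,
    Complex.exp (2 * Real.pi * Complex.I / p) ^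
      (Algebra.trace (ZMod p) F
        (a * w ⟨0, by omega⟩ + a * u * w ⟨1, by omega⟩ +
          ∑ i ∈ Finset.univ.filter (fun i : Fin k => 2 ≤ (i : ℕ)),
            (g i).eval a * (f i).eval u * w i)).val

/-- The exponential sum `ε_f = Σ_{x ∈ F_q} ζ_p^{Tr(f(x))}` of a polynomial `f` over `F_q`,
where `ζ_p = exp(2πi/p)` and `Tr : F_q → F_p` is the absolute trace. -/
noncomputable def expSum (p : ℕ) (F : Type) [Field F] [Fintype F] [Algebra (ZMod p) F]
    (f : Polynomial F) : ℂ :=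
  ∑ x : F, Complex.exp (2 * Real.pi * Complex.I / p) ^ (Algebra.trace (ZMod p) F (f.eval x)).val

open Polynomial

theorem Valuation.exists_sum_pow_eq_of_weights {K L Γ ι : Type*} [Field K] [Field L] [Algebra K L]
    [LinearOrderedCommGroupWithZero Γ] (v : Valuation L Γ)
    (hv : ∀ c : K, c ≠ 0 → v (algebraMap K L c) = 1) {z : Γ} (hz : 1 < z) {n : ℕ} (hn : n ≠ 0)
    (s : Finset ι) (c : ι → K) (m : ι → L) (wt : ι → ℕ) (hm : ∀ i ∈ s, v (m i) ^ n = z ^ wt i)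
    (hinj : Set.InjOn wt s) (hc : ∃ i ∈ s, c i ≠ 0) :
    ∃ i ∈ s, c i ≠ 0 ∧ v (∑ j ∈ s, c j • m j) ^ n = z ^ wt i ∧
      ∀ j ∈ s, c j ≠ 0 → wt j ≤ wt i := by
  classical
  obtain ⟨i, hi, hmax⟩ := Finset.exists_max_image (s.filter (c · ≠ 0)) wt
    (by simpa [Finset.Nonempty] using hc)
  rw [Finset.mem_filter] at hi
  have hmi : ∀ j, c j ≠ 0 → v (c j • m j) = v (m j) := fun j hj => by
    rw [Algebra.smul_def, map_mul, hv _ hj, one_mul]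
  refine ⟨i, hi.1, hi.2, ?_, fun j hj hcj => hmax j (Finset.mem_filter.2 ⟨hj, hcj⟩)⟩
  rw [v.map_sum_eq_of_lt hi.1, hmi i hi.2, hm i hi.1]
  intro j hj
  simp only [Finset.mem_sdiff, Finset.mem_singleton] at hj
  have hpos : v (m i) ≠ 0 := fun h => by
    have := hm i hi.1
    rw [h, zero_pow hn] at this
    exact (pow_ne_zero _ (zero_lt_one.trans hz).ne') this.symm
  by_cases hcj : c j = 0
  · rw [hmi i hi.2, hcj, zero_smul, map_zero]
    exact zero_lt_iff.2 hpos
  · rw [hmi i hi.2, hmi j hcj]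
    refine lt_of_pow_lt_pow_left₀ n zero_le ?_
    rw [hm i hi.1, hm j hj.1]
    exact pow_lt_pow_right₀ hz (lt_of_le_of_ne (hmax j (Finset.mem_filter.2 ⟨hj.1, hcj⟩))
      fun h => hj.2 (hinj hj.1 hi.1 h))

/-- An element that is transcendental over the constants is a pole of
some valuation that is trivial on the constants. -/
theorem Transcendental.exists_valuation {K L : Type*} [Field K] [Field L] [Algebra K L] {x : L}
    (hx : Transcendental K x) :
    ∃ V : ValuationSubring L, 1 < V.valuation x ∧
      ∀ c : K, c ≠ 0 → V.valuation (algebraMap K L c) = 1 := by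
  have hxR : x ∉ (integralClosure K L).toSubring := fun h => hx
    (IsIntegral.isAlgebraic h)
  have : IsIntegrallyClosedIn (integralClosure K L).toSubring L :=
    inferInstanceAs (IsIntegrallyClosedIn (integralClosure K L) L)
  obtain ⟨V, hV, hxV⟩ := Subring.exists_le_valuationSubring_of_isIntegrallyClosedIn hxR
  have hle : ∀ c : K, V.valuation (algebraMap K L c) ≤ 1 := fun c =>
    (V.valuation_le_one_iff _).2 (hV ((integralClosure K L).algebraMap_mem c))
  refine ⟨V, lt_of_not_ge fun h => hxV ((V.valuation_le_one_iff _).1 h), fun c hc => ?_⟩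
  refine le_antisymm (hle c) ?_
  have := hle c⁻¹
  rw [map_inv₀, map_inv₀] at this
  exact (inv_le_one₀ (zero_lt_iff.2 (by simpa using hc))).1 this

/-- The Artin-Schreier relation forces the ratio of the pole orders. -/
theorem Valuation.pow_eq_of_artinSchreier_cubic {K L Γ : Type*} [Field K] [Field L] [Algebra K L]
    [LinearOrderedCommGroupWithZero Γ] (v : Valuation L Γ)
    (hv : ∀ c : K, c ≠ 0 → v (algebraMap K L c) = 1) {p : ℕ} (hp : 2 ≤ p) {x y : L}
    (hx : 1 < v x) {a b c : K} (ha : a ≠ 0)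
    (hxy : y ^ p - y = a • x ^ 3 + b • x + algebraMap K L c) :
    v y ^ p = v x ^ 3 := by
  have hle : ∀ c : K, v (algebraMap K L c) ≤ 1 := fun c => by
    by_cases hc : c = 0
    · simp [hc]
    · exact (hv c hc).le
  have hx3 : v x < v x ^ 3 := by
    simpa using pow_lt_pow_right₀ hx (by norm_num : 1 < 3)
  have hax : v (a • x ^ 3) = v x ^ 3 := by
    rw [Algebra.smul_def, map_mul, hv a ha, one_mul, map_pow]
  have hbx : v (b • x) < v x ^ 3 := by
    rw [Algebra.smul_def, map_mul]
    exact lt_of_le_of_lt (mul_le_of_le_one_left' (hle b)) hx3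
  have hrhs : v (y ^ p - y) = v x ^ 3 := by
    rw [hxy, add_assoc, v.map_add_eq_of_lt_left, hax]
    rw [hax]
    exact v.map_add_lt hbx (lt_of_le_of_lt (hle c) (hx.trans hx3))
  have hy : 1 < v y := by
    by_contra! h
    have : v (y ^ p - y) ≤ 1 := v.map_sub_le (by rw [map_pow]; exact pow_le_one' h p) h
    rw [hrhs] at this
    exact absurd this (not_le.2 (hx.trans hx3))
  rw [← hrhs, v.map_sub_eq_of_lt_left, map_pow]
  rw [map_pow]
  simpa using pow_lt_pow_right₀ hy (by omega : 1 < p)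

section Rectangles

variable {K L Γ : Type*} [Field K] [Field L] [Algebra K L] [LinearOrderedCommGroupWithZero Γ]

/-- The bivariate polynomial with prescribed coefficients at `X ^ i * Y ^ j` for `i < J`,
`j < p`. -/
noncomputable def rectPoly (K : Type*) [Field K] (p J : ℕ) :
    (Fin J × Fin p → K) →ₗ[K] K[X][X] :=
  Fintype.linearCombination K fun ij => C (X ^ (ij.1 : ℕ)) * X ^ (ij.2 : ℕ)

theorem aevalAeval_monomial {A : Type*} [CommRing A] [Algebra K A] (x y : A) (i j : ℕ) :
    aevalAeval x y (C (X ^ i) * X ^ j : K[X][X]) = x ^ i * y ^ j := by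
  rw [map_mul, aevalAeval_C, map_pow, map_pow, aevalAeval_Y, aeval_X]

theorem aevalAeval_rectPoly {A : Type*} [CommRing A] [Algebra K A] (x y : A) (p J : ℕ)
    (c : Fin J × Fin p → K) :
    aevalAeval x y (rectPoly K p J c) = ∑ ij, c ij • (x ^ (ij.1 : ℕ) * y ^ (ij.2 : ℕ)) := by
  simp only [rectPoly, Fintype.linearCombination_apply, map_sum, map_smul, aevalAeval_monomial]

theorem rectPoly_coeff_eq {p J : ℕ} (hp : 0 < p) {A : K[X][X]} (hA : A.degree < p)
    (hJ : ∀ i j, J ≤ i → (A.coeff j).coeff i = 0) :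
    rectPoly K p J (fun ij => (A.coeff ij.2).coeff ij.1) = A := by
  have hcoeff : ∀ j, A.coeff j = ∑ i : Fin J, ((A.coeff j).coeff i) • (X : K[X]) ^ (i : ℕ) := by
    intro j
    ext n
    simp only [finsetSum_coeff, coeff_smul, coeff_X_pow, smul_eq_mul, mul_ite, mul_one, mul_zero]
    rw [Fin.sum_univ_eq_sum_range (fun i => if n = i then (A.coeff j).coeff i else 0) J,
      Finset.sum_ite_eq]
    split_ifs with h
    · rfl
    · exact hJ n j (by simpa using h)
  have hdeg : A.natDegree < p := by
    by_cases h0 : A = 0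
    · simpa [h0] using hp
    · exact (natDegree_lt_iff_degree_lt h0).2 hA
  rw [rectPoly, Fintype.linearCombination_apply, Fintype.sum_prod_type_right]
  conv_rhs => rw [as_sum_range' A p hdeg,
    ← Fin.sum_univ_eq_sum_range (fun j => monomial j (A.coeff j)) p]
  refine Finset.sum_congr rfl fun j _ => ?_
  conv_rhs => rw [hcoeff j]
  rw [map_sum]
  refine Finset.sum_congr rfl fun i _ => ?_
  rw [C_mul_X_pow_eq_monomial, smul_monomial]

theorem exists_coeff_coeff_bound (A : K[X][X]) :
    ∃ J, ∀ i j, J ≤ i → (A.coeff j).coeff i = 0 := by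
  refine ⟨A.support.sup (fun j => (A.coeff j).natDegree) + 1, fun i j hij => ?_⟩
  by_cases hj : j ∈ A.support
  · exact coeff_eq_zero_of_natDegree_lt
      (lt_of_le_of_lt (Finset.le_sup (f := fun j => (A.coeff j).natDegree) hj) hij)
  · rw [notMem_support_iff.1 hj, coeff_zero]

variable (v : Valuation L Γ) {p : ℕ} {x y : L}

theorem weight_injective (hp : p.Prime) (hp3 : p ≠ 3) (J : ℕ) :
    Function.Injective (fun ij : Fin J × Fin p => p * (ij.1 : ℕ) + 3 * (ij.2 : ℕ)) := by
  rintro ⟨i, j⟩ ⟨i', j'⟩ h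
  simp only at h
  have hcop : Nat.Coprime p 3 := (Nat.coprime_primes hp Nat.prime_three).2 hp3
  have hmod : 3 * (j : ℕ) ≡ 3 * (j' : ℕ) [MOD p] := by
    have : p * (i : ℕ) + 3 * (j : ℕ) ≡ p * (i' : ℕ) + 3 * (j' : ℕ) [MOD p] := by rw [h]
    simpa [Nat.ModEq, Nat.mul_add_mod] using this
  have hj : (j : ℕ) = j' :=
    Nat.ModEq.eq_of_lt_of_lt (Nat.ModEq.cancel_left_of_coprime hcop hmod) j.2 j'.2
  have hi : (i : ℕ) = i' := by
    rw [hj] at h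
    exact Nat.eq_of_mul_eq_mul_left hp.pos (by omega)
  exact Prod.ext (Fin.ext hi) (Fin.ext hj)

theorem weight_lt {J : ℕ} (ij : Fin J × Fin p) :
    p * (ij.1 : ℕ) + 3 * (ij.2 : ℕ) < p * (J + 2) := by
  have h1 := ij.1.2
  have h2 := ij.2.2
  nlinarith [Nat.mul_le_mul_left p (Nat.succ_le_of_lt h1)]

theorem Valuation.monomial_pow (hy : v y ^ p = v x ^ 3) (i j : ℕ) :
    v (x ^ i * y ^ j) ^ p = v x ^ (p * i + 3 * j) := by
  rw [map_mul, map_pow, map_pow, mul_pow, ← pow_mul, ← pow_mul, mul_comm j p, pow_mul (v y), hy,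
    ← pow_mul, pow_add, mul_comm i p]

theorem Valuation.sum_pow_lt {ι : Type*} (s : Finset ι) (f : ι → L) {g : Γ} (hg : 0 < g)
    (hp : p ≠ 0) (hf : ∀ i ∈ s, v (f i) ^ p < g) : v (∑ i ∈ s, f i) ^ p < g := by
  classical
  induction s using Finset.induction_on with
  | empty => simpa [hp] using hg
  | insert a s ha ih =>
    rw [Finset.sum_insert ha]
    have h1 := hf a (Finset.mem_insert_self a s)
    have h2 := ih fun i hi => hf i (Finset.mem_insert_of_mem hi)
    rcases le_max_iff.1 (v.map_add (f a) (∑ i ∈ s, f i)) with h | h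
    · exact lt_of_le_of_lt (pow_le_pow_left₀ zero_le h p) h1
    · exact lt_of_le_of_lt (pow_le_pow_left₀ zero_le h p) h2

theorem Valuation.smul_le (hv : ∀ c : K, c ≠ 0 → v (algebraMap K L c) = 1) (c : K) (z : L) :
    v (c • z) ≤ v z := by
  by_cases hc : c = 0
  · simp [hc]
  · rw [Algebra.smul_def, map_mul, hv c hc, one_mul]

theorem Valuation.exists_rectPoly_pow_eq (hv : ∀ c : K, c ≠ 0 → v (algebraMap K L c) = 1)
    (hp : p.Prime) (hp3 : p ≠ 3) (hx : 1 < v x) (hy : v y ^ p = v x ^ 3) {J : ℕ}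
    {c : Fin J × Fin p → K} (hc : c ≠ 0) :
    ∃ ij : Fin J × Fin p,
      v (aevalAeval x y (rectPoly K p J c)) ^ p = v x ^ (p * (ij.1 : ℕ) + 3 * (ij.2 : ℕ)) ∧
      ∀ kl : Fin J × Fin p, c kl ≠ 0 →
        p * (kl.1 : ℕ) + 3 * (kl.2 : ℕ) ≤ p * (ij.1 : ℕ) + 3 * (ij.2 : ℕ) := by
  obtain ⟨k, hk⟩ := Function.ne_iff.1 hc
  obtain ⟨i, -, -, h1, h2⟩ := v.exists_sum_pow_eq_of_weights hv hx hp.ne_zero Finset.univ c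
    (fun ij => x ^ (ij.1 : ℕ) * y ^ (ij.2 : ℕ)) (fun ij => p * (ij.1 : ℕ) + 3 * (ij.2 : ℕ))
    (fun ij _ => v.monomial_pow hy _ _) (weight_injective hp hp3 J).injOn
    ⟨k, Finset.mem_univ _, hk⟩
  exact ⟨i, by rw [aevalAeval_rectPoly, h1], fun j hj => h2 j (Finset.mem_univ _) hj⟩

theorem Valuation.aevalAeval_rectPoly_ne_zero (hv : ∀ c : K, c ≠ 0 → v (algebraMap K L c) = 1)
    (hp : p.Prime) (hp3 : p ≠ 3) (hx : 1 < v x) (hy : v y ^ p = v x ^ 3) {J : ℕ}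
    {c : Fin J × Fin p → K} (hc : c ≠ 0) : aevalAeval x y (rectPoly K p J c) ≠ 0 := by
  intro h
  obtain ⟨ij, h1, -⟩ := v.exists_rectPoly_pow_eq hv hp hp3 hx hy hc
  rw [h, map_zero, zero_pow hp.ne_zero] at h1
  exact pow_ne_zero _ (zero_lt_one.trans hx).ne' h1.symm

/-- Division by a relation of degree `p` in the second variable: the remainder has as few
monomials as the pole order permits. -/
theorem Valuation.exists_dvd_sub_rectPoly (hv : ∀ c : K, c ≠ 0 → v (algebraMap K L c) = 1)
    (hp : p.Prime) (hp3 : p ≠ 3) (hx : 1 < v x) (hy : v y ^ p = v x ^ 3) {g : K[X][X]}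
    (hg : g.Monic) (hgp : g.natDegree = p) (hgxy : aevalAeval x y g = 0) {A : K[X][X]} {J : ℕ}
    (hA : v (aevalAeval x y A) ^ p < v x ^ (p * J)) :
    ∃ c : Fin J × Fin p → K, g ∣ A - rectPoly K p J c := by
  set B := A %ₘ g with hB
  have hdvd : g ∣ A - B := by
    rw [hB, modByMonic_eq_sub_mul_div]
    exact ⟨A /ₘ g, by ring⟩
  have hBA : aevalAeval x y B = aevalAeval x y A := by
    obtain ⟨r, hr⟩ := hdvd
    have := congrArg (aevalAeval x y) hr
    rw [_root_.map_sub, _root_.map_mul, hgxy, zero_mul, sub_eq_zero] at this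
    exact this.symm
  have hBdeg : B.degree < p := by
    have := degree_modByMonic_lt A hg
    rwa [degree_eq_natDegree hg.ne_zero, hgp] at this
  obtain ⟨J₁, hJ₁⟩ := exists_coeff_coeff_bound B
  have hJ : ∀ i j, J ≤ i → (B.coeff j).coeff i = 0 := by
    intro i j hi
    by_contra hne
    have hiJ : i < J₁ := lt_of_not_ge fun h => hne (hJ₁ i j h)
    have hjp : j < p := by
      by_contra h
      rw [coeff_eq_zero_of_degree_lt (lt_of_lt_of_le hBdeg (by exact_mod_cast not_lt.1 h)),
        coeff_zero] at hne
      exact hne rfl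
    have hc : (fun ij : Fin J₁ × Fin p => (B.coeff ij.2).coeff ij.1) ≠ 0 := fun h =>
      hne (congrFun h (⟨i, hiJ⟩, ⟨j, hjp⟩))
    obtain ⟨kl, h1, h2⟩ := v.exists_rectPoly_pow_eq hv hp hp3 hx hy hc
    rw [rectPoly_coeff_eq hp.pos hBdeg hJ₁, hBA] at h1
    have h3 := h2 (⟨i, hiJ⟩, ⟨j, hjp⟩) hne
    rw [h1] at hA
    have h4 := (pow_lt_pow_iff_right₀ hx).1 hA
    simp only at h3
    have := Nat.mul_le_mul_left p hi
    omega
  exact ⟨_, by rwa [rectPoly_coeff_eq hp.pos hBdeg hJ]⟩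

/-- A polynomial vanishing at the generic point of the curve vanishes on the curve. -/
theorem Valuation.dvd_of_aevalAeval_eq_zero (hv : ∀ c : K, c ≠ 0 → v (algebraMap K L c) = 1)
    (hp : p.Prime) (hp3 : p ≠ 3) (hx : 1 < v x) (hy : v y ^ p = v x ^ 3) {g : K[X][X]}
    (hg : g.Monic) (hgp : g.natDegree = p) (hgxy : aevalAeval x y g = 0) {A : K[X][X]}
    (hA : aevalAeval x y A = 0) : g ∣ A := by
  obtain ⟨c, hc⟩ := v.exists_dvd_sub_rectPoly hv hp hp3 hx hy hg hgp hgxy (A := A) (J := 0)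
    (by simp [hA, hp.ne_zero])
  have : rectPoly K p 0 c = 0 := by
    rw [Subsingleton.elim c 0, map_zero]
  rwa [this, sub_zero] at hc

end Rectangles

section PointCount

variable {K L Γ : Type*} [Field K] [Field L] [Algebra K L] [LinearOrderedCommGroupWithZero Γ]

theorem exists_aevalAeval_eq_single [Fintype K] [DecidableEq K] (P : K × K) :
    ∃ A : K[X][X], ∀ R : K × K, aevalAeval R.1 R.2 A = if R = P then 1 else 0 := by
  refine ⟨C (1 - (X - C P.1) ^ (Fintype.card K - 1)) *
    (1 - (X - C (C P.2)) ^ (Fintype.card K - 1)), fun R => ?_⟩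
  have hone : ∀ s t : K, 1 - (s - t) ^ (Fintype.card K - 1) = if s = t then 1 else 0 := by
    intro s t
    split_ifs with h
    · have : Fintype.card K - 1 ≠ 0 := by have := Fintype.one_lt_card (α := K); omega
      rw [h, sub_self, zero_pow this, sub_zero]
    · rw [FiniteField.pow_card_sub_one_eq_one _ (sub_ne_zero.2 h), sub_self]
  rw [map_mul, aevalAeval_C]
  simp only [map_sub, map_one, map_pow, aeval_X, aeval_C, aevalAeval_C, aevalAeval_Y,
    Algebra.algebraMap_self, RingHom.id_apply, hone, Prod.ext_iff]
  split_ifs <;> simp_all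

/-- A function on the curve has at most as many zeros as poles, up to a constant. -/
theorem Valuation.card_zeros_le [Fintype K] (v : Valuation L Γ) {p : ℕ} {x y : L}
    (hv : ∀ c : K, c ≠ 0 → v (algebraMap K L c) = 1)
    (hp : p.Prime) (hp3 : p ≠ 3) (hx : 1 < v x) (hy : v y ^ p = v x ^ 3) {g : K[X][X]}
    (hg : g.Monic) (hgp : g.natDegree = p) (hgxy : aevalAeval x y g = 0) {H : K[X][X]} {D : ℕ}
    (hH0 : aevalAeval x y H ≠ 0) (hH : v (aevalAeval x y H) ^ p ≤ v x ^ (p * D))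
    (V : Finset (K × K)) (hVg : ∀ P ∈ V, aevalAeval P.1 P.2 g = 0)
    (hVH : ∀ P ∈ V, aevalAeval P.1 P.2 H = 0) : V.card ≤ p * (D + 2) := by
  classical
  choose A hA using exists_aevalAeval_eq_single (K := K)
  choose J₀ hJ₀ using fun P => exists_coeff_coeff_bound (A P %ₘ g)
  set I := V.sup J₀ with hI
  set J := I + D + 2 with hJ
  let ev : (Fin J × Fin p → K) →ₗ[K] (V → K) :=
    LinearMap.pi fun P => (aevalAeval P.1.1 P.1.2).toLinearMap ∘ₗ rectPoly K p J
  have hev : ∀ c (P : V), ev c P = aevalAeval P.1.1 P.1.2 (rectPoly K p J c) := fun _ _ => rfl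
  have hmod : ∀ (B : K[X][X]) (P : V),
      aevalAeval P.1.1 P.1.2 (B %ₘ g) = aevalAeval P.1.1 P.1.2 B := fun B P => by
    rw [modByMonic_eq_sub_mul_div, _root_.map_sub, _root_.map_mul, hVg P.1 P.2, zero_mul,
      sub_zero]
  have hsurj : Function.Surjective ev := by
    rw [← LinearMap.range_eq_top, eq_top_iff, ← (Pi.basisFun K V).span_eq, Submodule.span_le]
    rintro _ ⟨P, rfl⟩
    refine ⟨fun ij => ((A P %ₘ g).coeff ij.2).coeff ij.1, ?_⟩
    ext R
    rw [hev, rectPoly_coeff_eq hp.pos, hmod, hA, Pi.basisFun_apply, Pi.single_apply]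
    · simp only [Subtype.ext_iff]
    · have := degree_modByMonic_lt (A P) hg
      rwa [degree_eq_natDegree hg.ne_zero, hgp] at this
    · intro i j hij
      refine hJ₀ _ i j (le_trans ?_ hij)
      have : J₀ P ≤ I := Finset.le_sup P.2
      omega
  have hrank := ev.finrank_range_add_finrank_ker
  rw [LinearMap.range_eq_top.2 hsurj, finrank_top] at hrank
  simp only [Module.finrank_fintype_fun_eq_card, Fintype.card_prod, Fintype.card_fin,
    Fintype.card_coe] at hrank
  let EL : ∀ N, (Fin N × Fin p → K) →ₗ[K] L := fun N =>
    (aevalAeval x y).toLinearMap ∘ₗ rectPoly K p N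
  have hEL : ∀ N, Function.Injective (EL N) := fun N => by
    rw [← LinearMap.ker_eq_bot, LinearMap.ker_eq_bot']
    intro c hc
    by_contra hne
    exact v.aevalAeval_rectPoly_ne_zero hv hp hp3 hx hy hne hc
  let m : L →ₗ[K] L := LinearMap.mulRight K (aevalAeval x y H)
  have hm : Function.Injective m := fun s t hst => mul_right_cancel₀ hH0 hst
  have hle : LinearMap.range (m ∘ₗ EL I) ≤ (LinearMap.ker ev).map (EL J) := by
    rintro _ ⟨c, rfl⟩
    have hval : v (aevalAeval x y (rectPoly K p I c * H)) ^ p < v x ^ (p * J) := by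
      rw [_root_.map_mul, _root_.map_mul, mul_pow]
      by_cases hc : c = 0
      · simp only [hc, _root_.map_zero, zero_pow hp.ne_zero, zero_mul]
        exact zero_lt_iff.2 (pow_ne_zero _ (zero_lt_one.trans hx).ne')
      · obtain ⟨ij, h1, -⟩ := v.exists_rectPoly_pow_eq hv hp hp3 hx hy hc
        have h2 : v x ^ (p * (ij.1 : ℕ) + 3 * (ij.2 : ℕ)) < v x ^ (p * (I + 2)) :=
          pow_lt_pow_right₀ hx (weight_lt ij)
        calc _ ≤ v x ^ (p * (ij.1 : ℕ) + 3 * (ij.2 : ℕ)) * v x ^ (p * D) := by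
                rw [h1]; exact mul_le_mul_right hH _
          _ < v x ^ (p * (I + 2)) * v x ^ (p * D) := by
                refine (mul_lt_mul_iff_left₀ ?_).2 h2
                exact zero_lt_iff.2 (pow_ne_zero _ (zero_lt_one.trans hx).ne')
          _ = v x ^ (p * J) := by rw [← pow_add, hJ]; congr 1; ring
    obtain ⟨d, r, hd⟩ := v.exists_dvd_sub_rectPoly hv hp hp3 hx hy hg hgp hgxy hval
    refine ⟨d, ?_, ?_⟩
    · rw [SetLike.mem_coe, LinearMap.mem_ker]
      ext P
      have := congrArg (aevalAeval P.1.1 P.1.2) hd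
      rw [_root_.map_sub, _root_.map_mul, _root_.map_mul, hVg P.1 P.2, hVH P.1 P.2, zero_mul,
        mul_zero, zero_sub, neg_eq_zero] at this
      rw [hev, this, Pi.zero_apply]
    · have := congrArg (aevalAeval x y) hd
      rw [_root_.map_sub, _root_.map_mul, _root_.map_mul, hgxy, zero_mul, sub_eq_zero] at this
      exact this.symm
  have h1 := Submodule.finrank_mono hle
  have hinj : Function.Injective (m ∘ₗ EL I) := by
    rw [LinearMap.coe_comp]
    exact hm.comp (hEL I)
  rw [LinearMap.finrank_range_of_inj hinj] at h1
  have h2 := h1.trans (Submodule.finrank_map_le (EL J) (LinearMap.ker ev))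
  simp only [Module.finrank_fintype_fun_eq_card, Fintype.card_prod, Fintype.card_fin] at h2
  have h3 : J * p = I * p + p * (D + 2) := by rw [hJ]; ring
  omega

theorem exists_generic_point.{u} (K : Type u) [Field K] {p : ℕ} (hp : 2 ≤ p) (f : K[X]) :
    ∃ (L : Type u) (_ : Field L) (_ : Algebra K L) (x y : L),
      Transcendental K x ∧ y ^ p - y = aeval x f := by
  refine ⟨AlgebraicClosure (RatFunc K), inferInstance, inferInstance,
    algebraMap (RatFunc K) _ RatFunc.X, ?_⟩
  set x : AlgebraicClosure (RatFunc K) := algebraMap (RatFunc K) _ RatFunc.X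
  have hdeg : (X ^ p - X - C (aeval x f) : (AlgebraicClosure (RatFunc K))[X]).degree ≠ 0 := by
    rw [sub_sub, degree_sub_eq_left_of_degree_lt]
    · rw [degree_X_pow]
      exact_mod_cast (by omega : p ≠ 0)
    · rw [degree_X_pow, degree_X_add_C]
      exact_mod_cast (by omega : 1 < p)
  obtain ⟨y, hy⟩ := IsAlgClosed.exists_root _ hdeg
  refine ⟨y, ?_, ?_⟩
  · exact (transcendental_algebraMap_iff
      (FaithfulSMul.algebraMap_injective (RatFunc K) _)).2 RatFunc.transcendental_X
  · simpa [sub_eq_zero] using hy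

/-- The Artin-Schreier relation `Y ^ p - Y = f(X)` as a bivariate polynomial. -/
noncomputable def artinSchreierPoly {K : Type*} [Field K] (p : ℕ) (f : K[X]) : K[X][X] :=
  X ^ p - (X + C f)

theorem monic_artinSchreierPoly {p : ℕ} (hp : 2 ≤ p) (f : K[X]) :
    (artinSchreierPoly p f).Monic := by
  refine monic_X_pow_sub ?_
  rw [degree_X_add_C]
  exact_mod_cast (by omega : 1 < p)

theorem natDegree_artinSchreierPoly {p : ℕ} (hp : 2 ≤ p) (f : K[X]) :
    (artinSchreierPoly p f).natDegree = p := by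
  rw [artinSchreierPoly, natDegree_sub_eq_left_of_natDegree_lt, natDegree_X_pow]
  rw [natDegree_X_pow, natDegree_X_add_C]
  omega

theorem aevalAeval_artinSchreierPoly {A : Type*} [CommRing A] [Algebra K A] (p : ℕ) (f : K[X])
    (x y : A) : aevalAeval x y (artinSchreierPoly p f) = y ^ p - y - aeval x f := by
  rw [artinSchreierPoly, map_sub, map_add, map_pow, aevalAeval_C, aevalAeval_Y, sub_sub]

/-- The Stepanov–Bombieri method for the curve `y ^ p - y = a x ^ 3 + b x + c` over a
field with `P ^ 2` elements. -/
theorem card_artinSchreier_cubic_le [Fintype K] [DecidableEq K] {p : ℕ} (hp : p.Prime)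
    [CharP K p] (hp3 : p ≠ 3) {P μ : ℕ} (hP : P = p ^ μ) (hcard : Fintype.card K = P ^ 2)
    {a : K} (ha : a ≠ 0) (b c : K) {I I' : ℕ} (hI : p * (I + 2) ≤ P)
    (hI' : (I + 2) * P + I' + 2 < p * I * I') :
    (Finset.univ.filter fun R : K × K =>
      R.2 ^ p - R.2 = a * R.1 ^ 3 + b * R.1 + c).card ≤ p * (I + 4 + P * (I' + 2)) := by
  have := Fact.mk hp
  set f : K[X] := C a * X ^ 3 + C b * X + C c with hf
  obtain ⟨L, _, _, x, y, hx, hxy⟩ := exists_generic_point K hp.two_le f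
  obtain ⟨V, hVx, hv⟩ := hx.exists_valuation
  set v := V.valuation
  have hy : v y ^ p = v x ^ 3 := by
    refine v.pow_eq_of_artinSchreier_cubic hv hp.two_le hVx ha (b := b) (c := c) ?_
    rw [hxy, hf]
    simp [Algebra.smul_def]
  set g := artinSchreierPoly p f
  have hg := monic_artinSchreierPoly hp.two_le f
  have hgp := natDegree_artinSchreierPoly hp.two_le f
  have hgxy : aevalAeval x y g = 0 := by rw [aevalAeval_artinSchreierPoly, hxy, sub_self]
  have hz : (0 : V.ValueGroup) < v x := zero_lt_one.trans hVx
  -- The auxiliary function whose coefficients are found by linear algebra.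
  let mon : ∀ {N : ℕ}, Fin N × Fin p → K[X][X] := fun ij => C (X ^ (ij.1 : ℕ)) * X ^ (ij.2 : ℕ)
  let wt : ∀ {N : ℕ}, Fin N × Fin p → ℕ := fun ij => p * (ij.1 : ℕ) + 3 * (ij.2 : ℕ)
  have hmon : ∀ {N : ℕ} (ij : Fin N × Fin p), v (aevalAeval x y (mon ij)) ^ p = v x ^ wt ij :=
    fun ij => by rw [aevalAeval_monomial, v.monomial_pow hy]
  let G : ((Fin I × Fin p) × (Fin I' × Fin p) → K) →ₗ[K] K[X][X] :=
    Fintype.linearCombination K fun s => mon s.1 ^ P * mon s.2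
  have hG : ∀ d, G d = ∑ s, d s • (mon s.1 ^ P * mon s.2) := fun d => by
    simp only [G, Fintype.linearCombination_apply]
  set J := (I + 2) * P + I' + 2 with hJ
  let EJ : (Fin J × Fin p → K) →ₗ[K] L := (aevalAeval x y).toLinearMap ∘ₗ rectPoly K p J
  have hGJ : ∀ d, (aevalAeval x y).toLinearMap (G d) ∈ LinearMap.range EJ := by
    intro d
    have hval : v (aevalAeval x y (G d)) ^ p < v x ^ (p * J) := by
      rw [hG, map_sum]
      refine v.sum_pow_lt _ _ (pow_pos hz _) hp.ne_zero fun s _ => ?_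
      rw [map_smul]
      refine lt_of_le_of_lt (pow_le_pow_left₀ zero_le (v.smul_le hv _ _) p) ?_
      rw [map_mul, map_mul, mul_pow, map_pow, map_pow, ← pow_mul, mul_comm P p, pow_mul, hmon,
        hmon, ← pow_mul, ← pow_add]
      refine pow_lt_pow_right₀ hVx ?_
      have h1 := weight_lt s.1
      have h2 := weight_lt s.2
      have h3 := Nat.mul_le_mul_right P h1.le
      simp only [wt]
      nlinarith
    obtain ⟨e, r, he⟩ := v.exists_dvd_sub_rectPoly hv hp hp3 hVx hy hg hgp hgxy hval
    refine ⟨e, ?_⟩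
    have := congrArg (aevalAeval x y) he
    rw [map_sub, map_mul, hgxy, zero_mul, sub_eq_zero] at this
    exact this.symm
  obtain ⟨d, hd, hd0⟩ : ∃ d, aevalAeval x y (G d) = 0 ∧ d ≠ 0 := by
    let T : ((Fin I × Fin p) × (Fin I' × Fin p) → K) →ₗ[K] LinearMap.range EJ :=
      LinearMap.codRestrict _ ((aevalAeval x y).toLinearMap ∘ₗ G) hGJ
    have hlt : Module.finrank K (LinearMap.range EJ) <
        Module.finrank K ((Fin I × Fin p) × (Fin I' × Fin p) → K) := by
      refine lt_of_le_of_lt (LinearMap.finrank_range_le EJ) ?_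
      simp only [Module.finrank_fintype_fun_eq_card, Fintype.card_prod, Fintype.card_fin]
      have := Nat.mul_lt_mul_of_pos_right hI' hp.pos
      nlinarith
    obtain ⟨d, hd, hd0⟩ := Submodule.exists_mem_ne_zero_of_ne_bot
      (LinearMap.ker_ne_bot_of_finrank_lt (f := T) hlt)
    exact ⟨d, congrArg Subtype.val (LinearMap.mem_ker.1 hd), hd0⟩
  have hGdvd := v.dvd_of_aevalAeval_eq_zero hv hp hp3 hVx hy hg hgp hgxy hd
  let H : K[X][X] := ∑ s, d s ^ P • (mon s.1 * mon s.2 ^ P)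
  have hwt1 : ∀ s : Fin I × Fin p, wt s < P := fun s => (weight_lt s).trans_le hI
  have hinj : Function.Injective
      fun s : (Fin I × Fin p) × (Fin I' × Fin p) => wt s.1 + P * wt s.2 := by
    rintro ⟨s, t⟩ ⟨s', t'⟩ h
    simp only at h
    have h1 : wt s = wt s' := by
      have := congrArg (· % P) h
      simpa [Nat.add_mul_mod_self_left, Nat.mod_eq_of_lt (hwt1 _)] using this
    have h2 : wt t = wt t' := by
      rw [h1] at h
      exact Nat.eq_of_mul_eq_mul_left ((Nat.zero_le _).trans_lt (hwt1 s)) (by omega)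
    exact Prod.ext (weight_injective hp hp3 I h1) (weight_injective hp hp3 I' h2)
  obtain ⟨s₀, hs₀⟩ := Function.ne_iff.1 hd0
  obtain ⟨s, -, -, hHval, -⟩ := v.exists_sum_pow_eq_of_weights hv hVx hp.ne_zero Finset.univ
    (fun s => d s ^ P) (fun s => aevalAeval x y (mon s.1) * aevalAeval x y (mon s.2) ^ P)
    (fun s => wt s.1 + P * wt s.2)
    (fun s _ => by
      rw [map_mul, map_pow, mul_pow, hmon, ← pow_mul, mul_comm P p, pow_mul, hmon, ← pow_mul,
        ← pow_add, mul_comm P])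
    hinj.injOn ⟨s₀, Finset.mem_univ _, pow_ne_zero _ hs₀⟩
  have hHxy : aevalAeval x y H =
      ∑ s, d s ^ P • (aevalAeval x y (mon s.1) * aevalAeval x y (mon s.2) ^ P) := by
    simp only [H, map_sum, map_smul, map_mul, map_pow]
  rw [← hHxy] at hHval
  have hD : p * (I + 4 + P * (I' + 2)) = p * ((I + 2 + P * (I' + 2)) + 2) := by ring
  rw [hD]
  refine v.card_zeros_le hv hp hp3 hVx hy hg hgp hgxy (H := H) ?_ ?_ _ ?_ ?_
  · intro h
    rw [h, map_zero, zero_pow hp.ne_zero] at hHval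
    exact pow_ne_zero _ hz.ne' hHval.symm
  · rw [hHval]
    refine pow_le_pow_right₀ hVx.le ?_
    have h1 := (weight_lt s.1).le
    have h2 := Nat.mul_le_mul_left P (weight_lt s.2).le
    simp only [wt]
    nlinarith
  · intro R hR
    rw [Finset.mem_filter] at hR
    rw [aevalAeval_artinSchreierPoly, hR.2, hf]
    simp
  · intro R hR
    rw [Finset.mem_filter] at hR
    have hgR : aevalAeval R.1 R.2 g = 0 := by
      rw [aevalAeval_artinSchreierPoly, hR.2, hf]
      simp
    have hGR : aevalAeval R.1 R.2 (G d) = 0 := by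
      obtain ⟨r, hr⟩ := hGdvd
      rw [hr, map_mul, hgR, zero_mul]
    have hpow : ∀ t : K, (t ^ P) ^ P = t := fun t => by
      rw [← pow_mul, ← pow_two, ← hcard, FiniteField.pow_card]
    have hHP : aevalAeval R.1 R.2 H ^ P = aevalAeval R.1 R.2 (G d) := by
      rw [hG, map_sum, map_sum, hP, sum_pow_char_pow, ← hP]
      refine Finset.sum_congr rfl fun s _ => ?_
      simp only [map_smul, map_mul, map_pow, smul_eq_mul, mul_pow, hpow]
    rw [hGR] at hHP
    exact eq_zero_of_pow_eq_zero hHP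

end PointCount

section ExponentialSum

variable {K : Type*} [Field K] [Fintype K] {p : ℕ} [Fact p.Prime] [Algebra (ZMod p) K]

theorem trace_pow_char (y : K) :
    Algebra.trace (ZMod p) K (y ^ p) = Algebra.trace (ZMod p) K y := by
  have := Algebra.trace_eq_of_algEquiv
    (FiniteField.frobeniusAlgEquivOfAlgebraic (ZMod p) K) y
  simpa [ZMod.card] using this

/-- Additive Hilbert 90 for the absolute trace of a finite field. -/
theorem exists_pow_sub_eq_of_trace_eq_zero {z : K} (hz : Algebra.trace (ZMod p) K z = 0) :
    ∃ y : K, y ^ p - y = z := by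
  have := charP_of_injective_algebraMap (algebraMap (ZMod p) K).injective p
  let φ : K →ₗ[ZMod p] K := (FiniteField.frobeniusAlgHom (ZMod p) K).toLinearMap - LinearMap.id
  have hφ : ∀ y, φ y = y ^ p - y := fun y => by simp [φ, ZMod.card]
  have hle : LinearMap.range φ ≤ LinearMap.ker (Algebra.trace (ZMod p) K) := by
    rintro _ ⟨y, rfl⟩
    rw [LinearMap.mem_ker, hφ, map_sub, trace_pow_char, sub_self]
  have hker : Module.finrank (ZMod p) (LinearMap.ker φ) ≤ 1 := by
    have hp := (Fact.out : p.Prime)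
    refine (Nat.pow_le_pow_iff_right hp.one_lt).1 ?_
    have hne : (X ^ p - X : K[X]) ≠ 0 := FiniteField.X_pow_card_sub_X_ne_zero K hp.one_lt
    have h1 : (LinearMap.ker φ : Set K) ⊆ (X ^ p - X : K[X]).rootSet K := by
      intro y hy
      have : y ^ p - y = 0 := by rw [← hφ]; exact hy
      rw [mem_rootSet]
      exact ⟨hne, by simpa using this⟩
    have h2 := Set.ncard_le_ncard h1 (rootSet_finite _ _)
    have h3 : ((X ^ p - X : K[X]).rootSet K).ncard ≤ p := by
      have := ncard_rootSet_le (X ^ p - X : K[X]) K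
      rwa [FiniteField.X_pow_card_sub_X_natDegree_eq K hp.one_lt] at this
    have h4 : (LinearMap.ker φ : Set K).ncard = p ^ Module.finrank (ZMod p) (LinearMap.ker φ) := by
      have := Module.natCard_eq_pow_finrank (K := ZMod p) (V := LinearMap.ker φ)
      rw [Nat.card_zmod] at this
      rw [← this]
      rfl
    rw [pow_one]
    omega
  have h1 := φ.finrank_range_add_finrank_ker
  have h2 := (Algebra.trace (ZMod p) K).finrank_range_add_finrank_ker
  rw [LinearMap.range_eq_top.2 (Algebra.trace_surjective (ZMod p) K), finrank_top,
    Module.finrank_self] at h2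
  have heq := Submodule.eq_of_le_of_finrank_le hle (by omega)
  have hzmem : z ∈ LinearMap.range φ := by rw [heq]; exact hz
  obtain ⟨y, hy⟩ := hzmem
  exact ⟨y, by rw [← hφ, hy]⟩

theorem card_trace_cubic_eq_le [DecidableEq K] (hp3 : p ≠ 3) {r μ : ℕ} (hr : 16 ≤ r)
    (hP : p * r = p ^ μ) (hcard : Fintype.card K = (p * r) ^ 2) {a : K} (ha : a ≠ 0) (b : K)
    (t : ZMod p) :
    (Finset.univ.filter fun x : K => Algebra.trace (ZMod p) K (a * x ^ 3 + b * x) = t).card ≤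
      r * (p * r) + 9 * (p * r) := by
  have hp := (Fact.out : p.Prime)
  have := charP_of_injective_algebraMap (algebraMap (ZMod p) K).injective p
  obtain ⟨γ, hγ⟩ := Algebra.trace_surjective (ZMod p) K t
  obtain ⟨I, rfl⟩ : ∃ I, r = I + 2 := ⟨r - 2, by omega⟩
  have hbound := card_artinSchreier_cubic_le hp hp3 hP hcard ha b (-γ) (I := I) (I' := I + 6)
    le_rfl (by nlinarith [hp.two_le, Nat.mul_le_mul_right I hp.two_le])
  have hex : ∀ x : K, Algebra.trace (ZMod p) K (a * x ^ 3 + b * x) = t →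
      ∃ y : K, y ^ p - y = a * x ^ 3 + b * x + -γ := fun x hx =>
    exists_pow_sub_eq_of_trace_eq_zero (by rw [← sub_eq_add_neg, map_sub, hx, hγ, sub_self])
  choose! y hy using hex
  have hcard' : (Finset.univ.filter fun x : K =>
      Algebra.trace (ZMod p) K (a * x ^ 3 + b * x) = t).card * p ≤
      (Finset.univ.filter fun R : K × K =>
        R.2 ^ p - R.2 = a * R.1 ^ 3 + b * R.1 + -γ).card := by
    have hprod : ∀ s : Finset K, s.card * p = (s ×ˢ (Finset.univ : Finset (ZMod p))).card := by
      intro s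
      rw [Finset.card_product, Finset.card_univ, ZMod.card]
    rw [hprod]
    refine Finset.card_le_card_of_injOn (fun s => (s.1, y s.1 + algebraMap (ZMod p) K s.2)) ?_ ?_
    · rintro ⟨x, s⟩ hxs
      simp only [Finset.coe_product, Set.mem_prod, Finset.coe_filter, Set.mem_ofPred_eq,
        Finset.mem_univ, true_and] at hxs ⊢
      rw [add_pow_char, ← map_pow, ZMod.pow_card, add_sub_add_right_eq_sub, hy x hxs.1]
    · rintro ⟨x, s⟩ - ⟨x', s'⟩ - h
      simp only [Prod.mk.injEq] at h
      obtain ⟨rfl, h⟩ := h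
      exact Prod.ext rfl ((algebraMap (ZMod p) K).injective (add_left_cancel h))
  have h1 := hcard'.trans hbound
  rw [mul_comm] at h1
  have h2 := Nat.le_of_mul_le_mul_left h1 hp.pos
  nlinarith [Nat.mul_le_mul_right I hp.two_le, hp.two_le]

/-- The Weil bound for cubics over fields of square order, up to a constant depending only on
the characteristic. -/
theorem norm_sum_addChar_cubic_le (hp3 : p ≠ 3) {r μ : ℕ} (hr : 16 ≤ r)
    (hP : p * r = p ^ μ) (hcard : Fintype.card K = (p * r) ^ 2) {a : K} (ha : a ≠ 0) (b : K)
    {χ : AddChar (ZMod p) ℂ} (hχ : χ ≠ 1) :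
    ‖∑ x : K, χ (Algebra.trace (ZMod p) K (a * x ^ 3 + b * x))‖ ≤ 9 * p * (p * r) := by
  classical
  set N : ZMod p → ℕ := fun t => (Finset.univ.filter fun x : K =>
    Algebra.trace (ZMod p) K (a * x ^ 3 + b * x) = t).card with hN
  have hsum : ∑ x : K, χ (Algebra.trace (ZMod p) K (a * x ^ 3 + b * x)) =
      ∑ t, (N t : ℂ) * χ t := by
    rw [← Finset.sum_fiberwise_of_maps_to (s := Finset.univ) (t := Finset.univ)
      (g := fun x : K => Algebra.trace (ZMod p) K (a * x ^ 3 + b * x))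
      (fun _ _ => Finset.mem_univ _)]
    refine Finset.sum_congr rfl fun t _ => ?_
    rw [Finset.sum_congr rfl (g := fun _ => χ t) fun x hx => by rw [(Finset.mem_filter.1 hx).2],
      Finset.sum_const, nsmul_eq_mul]
  have htot : ∑ t, N t = (p * r) ^ 2 := by
    rw [← hcard, ← Finset.card_univ, Finset.card_eq_sum_card_fiberwise
      (f := fun x : K => Algebra.trace (ZMod p) K (a * x ^ 3 + b * x)) (t := Finset.univ)
      (fun _ _ => Finset.mem_coe.2 (Finset.mem_univ _))]
  set B : ℕ := r * (p * r) + 9 * (p * r) with hB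
  have hNB : ∀ t, N t ≤ B := fun t => card_trace_cubic_eq_le hp3 hr hP hcard ha b t
  have hshift : ∑ t, (N t : ℂ) * χ t = -∑ t, ((B - N t : ℕ) : ℂ) * χ t := by
    rw [← Finset.sum_neg_distrib, ← sub_eq_zero, ← Finset.sum_sub_distrib]
    rw [Finset.sum_congr rfl (g := fun t => (B : ℂ) * χ t) fun t _ => by
      rw [Nat.cast_sub (hNB t)]; ring, ← Finset.mul_sum, AddChar.sum_eq_zero_of_ne_one hχ, mul_zero]
  rw [hsum, hshift, norm_neg]
  refine (norm_sum_le _ _).trans ?_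
  have : ∀ t, ‖((B - N t : ℕ) : ℂ) * χ t‖ = (B : ℝ) - N t := fun t => by
    rw [norm_mul, AddChar.norm_apply, mul_one, Complex.norm_natCast, Nat.cast_sub (hNB t)]
  simp only [this, Finset.sum_sub_distrib, Finset.sum_const, Finset.card_univ, ZMod.card,
    nsmul_eq_mul, ← Nat.cast_sum, htot]
  refine le_of_eq ?_
  rw [hB]
  push_cast
  ring

end ExponentialSum

section QuadraticExtension

theorem sum_comp_sq_add_sum_comp_mul_sq {F : Type*} [Field F] [Fintype F] (hF : ringChar F ≠ 2)
    {δ : F} (hδ : ¬IsSquare δ) (h : F → ℂ) :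
    ∑ d, h (d ^ 2) + ∑ d, h (δ * d ^ 2) = 2 * ∑ x, h x := by
  classical
  have hδ0 : δ ≠ 0 := by rintro rfl; exact hδ (IsSquare.zero)
  have hcount : ∀ k : F → ℂ, ∑ d, k (d ^ 2) = ∑ x, ((quadraticChar F x : ℤ) + 1 : ℂ) * k x := by
    intro k
    rw [← Finset.sum_fiberwise_of_maps_to (s := Finset.univ) (t := Finset.univ)
      (g := fun d : F => d ^ 2) (fun _ _ => Finset.mem_univ _)]
    refine Finset.sum_congr rfl fun x _ => ?_
    rw [Finset.sum_congr rfl (g := fun _ => k x) fun d hd => by rw [(Finset.mem_filter.1 hd).2],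
      Finset.sum_const, nsmul_eq_mul]
    congr 1
    have := quadraticChar_card_sqrts hF x
    rw [Set.toFinset_ofPred] at this
    exact_mod_cast this
  have hchar : ∀ x, quadraticChar F (δ * x) = -quadraticChar F x := fun x => by
    rw [map_mul, quadraticChar_neg_one_iff_not_isSquare.2 hδ, neg_one_mul]
  have h2 : ∑ x, ((quadraticChar F x : ℤ) + 1 : ℂ) * h (δ * x) =
      ∑ x, (-(quadraticChar F x : ℤ) + 1 : ℂ) * h x := by
    refine Fintype.sum_equiv (Equiv.mulLeft₀ δ hδ0) _ _ fun x => ?_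
    rw [Equiv.mulLeft₀_apply, hchar]
    push_cast
    ring
  rw [hcount h, hcount fun x => h (δ * x), h2, ← Finset.sum_add_distrib, Finset.mul_sum]
  exact Finset.sum_congr rfl fun x _ => by ring

variable {F E : Type*} [Field F] [Fintype F] [Field E] [Fintype E] [Algebra F E]

theorem exists_sq_eq_algebraMap_and_trace_eq_zero (hF : ringChar F ≠ 2)
    (hE : Fintype.card E = Fintype.card F ^ 2) {δ : F} (hδ : ¬IsSquare δ) :
    ∃ θ : E, θ ^ 2 = algebraMap F E δ ∧ Algebra.trace F E θ = 0 := by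
  have hδ0 : δ ≠ 0 := by rintro rfl; exact hδ (IsSquare.zero)
  have hEchar : ringChar E ≠ 2 := by rwa [← Algebra.ringChar_eq F E]
  obtain ⟨j, hj⟩ : ∃ j, Fintype.card F = 2 * j + 1 :=
    Nat.odd_iff.2 (FiniteField.odd_card_of_char_ne_two hF)
  have hhalf : Fintype.card F / 2 = j := by omega
  have hpow : δ ^ j = -1 := by
    have := FiniteField.pow_dichotomy hF hδ0
    rw [hhalf] at this
    refine this.resolve_left fun h => hδ ?_
    rw [FiniteField.isSquare_iff hF hδ0, hhalf, h]
  have hsq : IsSquare (algebraMap F E δ) := by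
    rw [FiniteField.isSquare_iff hEchar (by simpa using hδ0)]
    have : Fintype.card E / 2 = j * (2 * (j + 1)) := by
      rw [hE, hj, show (2 * j + 1) ^ 2 = 2 * (j * (2 * (j + 1))) + 1 by ring]
      omega
    rw [this, ← map_pow, pow_mul, hpow, pow_mul, neg_one_sq, one_pow, map_one]
  obtain ⟨θ, hθ⟩ := hsq
  rw [← sq] at hθ
  refine ⟨θ, hθ.symm, (algebraMap F E).injective ?_⟩
  have hrank : Module.finrank F E = 2 := by
    have := Module.card_eq_pow_finrank (K := F) (V := E)
    rw [hE] at this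
    exact (Nat.pow_right_injective Fintype.one_lt_card this).symm
  rw [FiniteField.algebraMap_trace_eq_sum_pow, hrank, Finset.sum_range_succ, Finset.sum_range_one,
    pow_zero, pow_one, pow_one, Nat.card_eq_fintype_card, hj, pow_succ, pow_mul, ← hθ, ← map_pow,
    hpow, map_zero, map_neg, map_one]
  ring

variable {p : ℕ} [Fact p.Prime] [Algebra (ZMod p) F] [Algebra (ZMod p) E]
  [IsScalarTower (ZMod p) F E]

theorem sum_addChar_trace_mul {χ : AddChar (ZMod p) ℂ} (hχ : χ ≠ 1) {c : F} (hc : c ≠ 0) :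
    ∑ x : F, χ (Algebra.trace (ZMod p) F (c * x)) = 0 := by
  let ψ : AddChar F ℂ := χ.compAddMonoidHom
    ((Algebra.trace (ZMod p) F).toAddMonoidHom.comp (AddMonoidHom.mulLeft c))
  refine AddChar.sum_eq_zero_of_ne_one (ψ := ψ) fun h => hχ ?_
  ext t
  obtain ⟨y, hy⟩ := Algebra.trace_surjective (ZMod p) F t
  have := DFunLike.congr_fun h (c⁻¹ * y)
  simpa [ψ, mul_inv_cancel_left₀ hc, hy] using this

/-- The relation between a cubic exponential sum and its lift to the quadratic extension. -/
theorem sum_addChar_cubic_quadratic (hp2 : p ≠ 2) (hp3 : p ≠ 3)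
    (hE : Fintype.card E = Fintype.card F ^ 2) {χ : AddChar (ZMod p) ℂ} (hχ : χ ≠ 1)
    {a : F} (ha : a ≠ 0) (b : F) :
    ∑ x : E, χ (Algebra.trace (ZMod p) E (algebraMap F E a * x ^ 3 + algebraMap F E b * x)) =
      2 * Fintype.card F -
        (∑ x : F, χ (Algebra.trace (ZMod p) F (a * x ^ 3 + b * x))) ^ 2 := by
  classical
  have hp := (Fact.out : p.Prime)
  have hchar := charP_of_injective_algebraMap (algebraMap (ZMod p) F).injective p
  have hF : ringChar F ≠ 2 := by rwa [ringChar.eq F p]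
  have h2 : (2 : F) ≠ 0 := Ring.two_ne_zero hF
  have h3 : (3 : F) ≠ 0 := by
    intro h
    have : p ∣ 3 := (CharP.cast_eq_zero_iff F p 3).1 (by exact_mod_cast h)
    exact hp3 ((Nat.prime_dvd_prime_iff_eq hp Nat.prime_three).1 this)
  obtain ⟨δ, hδ⟩ := FiniteField.exists_nonsquare hF
  obtain ⟨θ, hθ, htr⟩ := exists_sq_eq_algebraMap_and_trace_eq_zero (E := E) hF hE hδ
  have hrank : Module.finrank F E = 2 := by
    have := Module.card_eq_pow_finrank (K := F) (V := E)
    rw [hE] at this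
    exact (Nat.pow_right_injective Fintype.one_lt_card this).symm
  let ψ : F → ℂ := fun x => χ (Algebra.trace (ZMod p) F x)
  have hψ : ∀ x y, ψ (x + y) = ψ x * ψ y := fun x y => by
    simp only [ψ, map_add, AddChar.map_add_eq_mul]
  let h : F → F → ℂ := fun c D => ψ (2 * (a * c ^ 3 + b * c) + 6 * a * c * D)
  have hsplit : (∑ x : F, ψ (a * x ^ 3 + b * x)) ^ 2 = ∑ c, ∑ d, h c (d ^ 2) := by
    have hbij : Function.Bijective fun s : F × F => (s.1 + s.2, s.1 - s.2) := by
      refine Finite.injective_iff_bijective.1 ?_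
      rintro ⟨c, d⟩ ⟨c', d'⟩ hs
      simp only [Prod.mk.injEq] at hs ⊢
      constructor
      · exact mul_left_cancel₀ h2 (by linear_combination hs.1 + hs.2)
      · exact mul_left_cancel₀ h2 (by linear_combination hs.1 - hs.2)
    rw [sq, Finset.sum_mul_sum, ← Fintype.sum_prod_type', ← Fintype.sum_prod_type']
    symm
    refine Fintype.sum_bijective _ hbij _ _ fun s => ?_
    rw [← hψ]
    simp only [h]
    congr 1
    ring
  have hnonsplit : ∑ x : E, χ (Algebra.trace (ZMod p) E
      (algebraMap F E a * x ^ 3 + algebraMap F E b * x)) = ∑ c, ∑ d, h c (δ * d ^ 2) := by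
    have hbij : Function.Bijective
        fun s : F × F => algebraMap F E s.1 + algebraMap F E s.2 * θ := by
      rw [Fintype.bijective_iff_injective_and_card]
      refine ⟨?_, by rw [Fintype.card_prod, hE, sq]⟩
      rintro ⟨c, d⟩ ⟨c', d'⟩ hs
      simp only at hs
      have hd : d = d' := by
        by_contra hne
        have hne' : d - d' ≠ 0 := sub_ne_zero.2 hne
        have hmul : algebraMap F E (d - d') * θ = algebraMap F E (c' - c) := by
          rw [map_sub, map_sub]
          linear_combination hs
        refine hδ ⟨(c' - c) / (d - d'), (algebraMap F E).injective ?_⟩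
        rw [← sq, ← hθ, map_pow, map_div₀, ← hmul, mul_div_cancel_left₀]
        exact (_root_.map_ne_zero _).2 hne'
      subst hd
      simpa using hs
    rw [← Fintype.sum_prod_type']
    symm
    refine Fintype.sum_bijective _ hbij _ _ fun s => ?_
    simp only [h, ψ]
    congr 1
    have hx : algebraMap F E a * (algebraMap F E s.1 + algebraMap F E s.2 * θ) ^ 3 +
        algebraMap F E b * (algebraMap F E s.1 + algebraMap F E s.2 * θ) =
        algebraMap F E (a * s.1 ^ 3 + b * s.1 + 3 * a * s.1 * (δ * s.2 ^ 2)) +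
        (3 * a * s.1 ^ 2 * s.2 + a * s.2 ^ 3 * δ + b * s.2) • θ := by
      simp only [Algebra.smul_def, map_add, map_mul, map_pow, map_ofNat, ← hθ]
      ring
    rw [hx, ← Algebra.trace_trace (S := F) (T := E), map_add (Algebra.trace F E),
      map_smul, htr, smul_zero, add_zero, Algebra.trace_algebraMap, hrank, nsmul_eq_mul]
    congr 1
    push_cast
    ring
  have hinner : ∀ c, ∑ D, h c D = if c = 0 then (Fintype.card F : ℂ) else 0 := by
    intro c
    split_ifs with hc
    · subst hc
      simp [h, ψ]
    · simp only [h, hψ, ← Finset.mul_sum, ψ]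
      have h6 : 6 * a * c ≠ 0 := by
        rw [show (6 : F) = 2 * 3 by norm_num]
        exact mul_ne_zero (mul_ne_zero (mul_ne_zero h2 h3) ha) hc
      rw [sum_addChar_trace_mul hχ h6, mul_zero]
  rw [hnonsplit, hsplit, eq_sub_iff_add_eq, add_comm, ← Finset.sum_add_distrib]
  simp only [sum_comp_sq_add_sum_comp_mul_sq hF hδ, hinner, ← Finset.mul_sum]
  simp

end QuadraticExtension

section Weil

variable {p : ℕ} [Fact p.Prime]

theorem norm_sum_addChar_cubic_le_of_pow (hp2 : p ≠ 2) (hp3 : p ≠ 3) {χ : AddChar (ZMod p) ℂ}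
    (hχ : χ ≠ 1) (n : ℕ) : ∀ (F : Type) [Field F] [Fintype F] [Algebra (ZMod p) F] (m μ : ℕ),
    Fintype.card F = p ^ m → 2 ^ n * m = 2 * μ → 4 ≤ μ → ∀ a b : F, a ≠ 0 →
    ‖∑ x : F, χ (Algebra.trace (ZMod p) F (a * x ^ 3 + b * x))‖ ≤
      (2 + 9 * p / 4 ^ n) * √(Fintype.card F) := by
  have hp := (Fact.out : p.Prime)
  induction n with
  | zero =>
    intro F _ _ _ m μ hcard hm hμ a b ha
    obtain ⟨ν, rfl⟩ : ∃ ν, μ = ν + 1 := ⟨μ - 1, by omega⟩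
    have hr : 16 ≤ p ^ ν := by
      have h3 : 3 ≤ p := by have := hp.two_le; omega
      calc 16 ≤ 3 ^ 3 := by norm_num
        _ ≤ p ^ 3 := Nat.pow_le_pow_left h3 3
        _ ≤ p ^ ν := Nat.pow_le_pow_right hp.pos (by omega)
    have hF : Fintype.card F = (p * p ^ ν) ^ 2 := by
      rw [hcard, ← pow_succ', ← pow_mul]
      congr 1
      omega
    have := norm_sum_addChar_cubic_le hp3 hr (pow_succ' p ν).symm hF ha b hχ
    refine this.trans ?_
    rw [hF, Nat.cast_pow (p * p ^ ν) 2, Real.sqrt_sq (by positivity)]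
    push_cast
    rw [pow_zero, div_one]
    gcongr
    linarith
  | succ n ih =>
    intro F _ _ _ m μ hcard hm hμ a b ha
    have hchar := charP_of_injective_algebraMap (algebraMap (ZMod p) F).injective p
    let E := FiniteField.Extension F p 2
    have : Fintype E := Fintype.ofFinite E
    have hE : Fintype.card E = Fintype.card F ^ 2 := by
      have := FiniteField.natCard_extension F p 2
      rwa [Nat.card_eq_fintype_card, Nat.card_eq_fintype_card] at this
    have hrec := ih E (2 * m) μ (by rw [hE, hcard, ← pow_mul, mul_comm]) (by rw [← hm]; ring) hμ
      (algebraMap F E a) (algebraMap F E b) (by simpa using ha)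
    rw [sum_addChar_cubic_quadratic hp2 hp3 hE hχ ha b, hE, Nat.cast_pow,
      Real.sqrt_sq (by positivity)] at hrec
    set S := ∑ x : F, χ (Algebra.trace (ZMod p) F (a * x ^ 3 + b * x)) with hS
    have htri : ‖S‖ ^ 2 ≤ ‖2 * (Fintype.card F : ℂ) - S ^ 2‖ + 2 * Fintype.card F := by
      have := norm_sub_le (2 * (Fintype.card F : ℂ)) (2 * (Fintype.card F : ℂ) - S ^ 2)
      rw [sub_sub_cancel, norm_pow, norm_mul, Complex.norm_natCast, Complex.norm_ofNat] at this
      linarith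
    refine abs_le_of_sq_le_sq' ?_ (by positivity) |>.2
    rw [mul_pow, Real.sq_sqrt (by positivity), pow_succ (4 : ℝ)]
    set ε : ℝ := 9 * p / (4 ^ n * 4) with hε
    have hε' : (9 * p / 4 ^ n : ℝ) = 4 * ε := by rw [hε]; field_simp
    rw [hε'] at hrec
    nlinarith [mul_nonneg (sq_nonneg ε) (Nat.cast_nonneg (α := ℝ) (Fintype.card F))]

/-- The Weil bound for cubic exponential sums in characteristic different from `2` and `3`. -/
theorem norm_sum_addChar_cubic_le_two_mul_sqrt (hp2 : p ≠ 2) (hp3 : p ≠ 3)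
    {χ : AddChar (ZMod p) ℂ} (hχ : χ ≠ 1) (F : Type) [Field F] [Fintype F] [Algebra (ZMod p) F]
    {a : F} (ha : a ≠ 0) (b : F) :
    ‖∑ x : F, χ (Algebra.trace (ZMod p) F (a * x ^ 3 + b * x))‖ ≤ 2 * √(Fintype.card F) := by
  have hcard := Module.card_eq_pow_finrank (K := ZMod p) (V := F)
  rw [ZMod.card] at hcard
  have hpos : 0 < Module.finrank (ZMod p) F := Module.finrank_pos
  have hlim : Filter.Tendsto (fun n : ℕ => (2 + 9 * p * ((4 : ℝ)⁻¹) ^ n) * √(Fintype.card F))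
      Filter.atTop (nhds ((2 + 9 * p * 0) * √(Fintype.card F))) :=
    ((tendsto_pow_atTop_nhds_zero_of_lt_one (by norm_num) (by norm_num)).const_mul _
      |>.const_add _).mul_const _
  rw [mul_zero, add_zero] at hlim
  refine ge_of_tendsto hlim (Filter.eventually_atTop.2 ⟨3, fun n hn => ?_⟩)
  obtain ⟨l, rfl⟩ : ∃ l, n = l + 3 := ⟨n - 3, by omega⟩
  have := norm_sum_addChar_cubic_le_of_pow hp2 hp3 hχ (l + 3) F _
    (2 ^ (l + 2) * Module.finrank (ZMod p) F) hcard (by ring)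
    (by nlinarith [Nat.one_le_two_pow (n := l), pow_add 2 l 2]) a b ha
  rwa [div_eq_mul_inv, ← inv_pow] at this

end Weil

section CubicSum

variable {F : Type} [Field F] [Fintype F] {p : ℕ} [Fact p.Prime] [Algebra (ZMod p) F]

theorem sum_addChar_cubic_eq_re (χ : AddChar (ZMod p) ℂ) (a b : F) :
    ∑ x : F, χ (Algebra.trace (ZMod p) F (a * x ^ 3 + b * x)) =
      ((∑ x : F, χ (Algebra.trace (ZMod p) F (a * x ^ 3 + b * x))).re : ℂ) := by
  refine (Complex.conj_eq_iff_re.1 ?_).symm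
  rw [map_sum]
  refine Fintype.sum_equiv (Equiv.neg F) _ _ fun x => ?_
  rw [← AddChar.map_neg_eq_conj, ← map_neg, Equiv.neg_apply]
  congr 2
  ring

theorem sum_addChar_cube_eq_zero (hF : Fintype.card F % 3 = 2) {χ : AddChar (ZMod p) ℂ}
    (hχ : χ ≠ 1) {a : F} (ha : a ≠ 0) :
    ∑ x : F, χ (Algebra.trace (ZMod p) F (a * x ^ 3)) = 0 := by
  have hinj : Function.Injective fun x : F => x ^ 3 := by
    obtain ⟨j, hj⟩ : ∃ j, Fintype.card F = 3 * j + 2 := ⟨Fintype.card F / 3, by omega⟩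
    have hpow : ∀ x : F, (x ^ 3) ^ (2 * j + 1) = x := fun x => by
      rw [← pow_mul, show 3 * (2 * j + 1) = (3 * j + 2) + (3 * j + 1) by ring, pow_add, ← hj,
        FiniteField.pow_card, ← pow_succ', show 3 * j + 1 + 1 = 3 * j + 2 by ring, ← hj,
        FiniteField.pow_card]
    intro x y hxy
    rw [← hpow x, ← hpow y]
    exact congrArg (· ^ (2 * j + 1)) hxy
  rw [← sum_addChar_trace_mul hχ ha]
  exact Fintype.sum_bijective _ (Finite.injective_iff_bijective.1 hinj) _ _ fun _ => rfl

/-- A family of cubic sums whose linear coefficient is a nonzero affine function is bounded by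
the maximum of the cubic sums with nonzero coefficients. -/
theorem sum_re_sum_addChar_cubic_le [DecidableEq F] (hF : Fintype.card F % 3 = 2)
    {χ : AddChar (ZMod p) ℂ} (hχ : χ ≠ 1) {M : ℝ} (hM0 : -(Fintype.card F : ℝ) ≤ M)
    (hM : ∀ a b : F, a ≠ 0 → b ≠ 0 →
      (∑ x : F, χ (Algebra.trace (ZMod p) F (a * x ^ 3 + b * x))).re ≤ M)
    (A : F → F) {w₁ w₂ : F} (hw : ¬(w₁ = 0 ∧ w₂ = 0)) :
    ∑ u : F, (∑ x : F, χ (Algebra.trace (ZMod p) F (A u * x ^ 3 + (w₁ + u * w₂) * x))).re ≤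
      (Fintype.card F - (Finset.univ.filter fun u => A u = 0).card) * M + Fintype.card F := by
  have hpt : ∀ u : F,
      (∑ x : F, χ (Algebra.trace (ZMod p) F (A u * x ^ 3 + (w₁ + u * w₂) * x))).re ≤
      (M - if A u = 0 then M else 0) + if w₁ + u * w₂ = 0 then (Fintype.card F : ℝ) else 0 := by
    intro u
    by_cases hA : A u = 0 <;> by_cases hl : w₁ + u * w₂ = 0
    · simp [hA, hl]
    · simp [hA, hl, sum_addChar_trace_mul hχ hl]
    · simp only [hA, hl, zero_mul, add_zero, sum_addChar_cube_eq_zero hF hχ hA, if_true, if_false,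
        Complex.zero_re]
      linarith
    · simpa [hA, hl] using hM _ _ hA hl
  have hroot : (Finset.univ.filter fun u : F => w₁ + u * w₂ = 0).card ≤ 1 := by
    refine Finset.card_le_one.2 fun u hu v hv => ?_
    simp only [Finset.mem_filter, Finset.mem_univ, true_and] at hu hv
    have hw₂ : w₂ ≠ 0 := by
      rintro rfl
      exact hw ⟨by simpa using hu, rfl⟩
    exact mul_right_cancel₀ hw₂ (by linear_combination hu - hv)
  refine (Finset.sum_le_sum fun u _ => hpt u).trans ?_
  rw [Finset.sum_add_distrib, Finset.sum_sub_distrib, ← Finset.sum_filter, ← Finset.sum_filter]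
  simp only [Finset.sum_const, nsmul_eq_mul, Finset.card_univ]
  have : ((Finset.univ.filter fun u : F => w₁ + u * w₂ = 0).card : ℝ) ≤ 1 := by
    exact_mod_cast hroot
  nlinarith [Nat.cast_nonneg (α := ℝ) (Fintype.card F)]

end CubicSum

theorem exists_addChar_zmod_eq_exp_pow {p : ℕ} (hp : p.Prime) :
    ∃ χ : AddChar (ZMod p) ℂ, χ ≠ 1 ∧
      ∀ t, Complex.exp (2 * Real.pi * Complex.I / p) ^ t.val = χ t := by
  have : Fact p.Prime := ⟨hp⟩
  have : Fact (1 < p) := ⟨hp.one_lt⟩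
  have hprim := Complex.isPrimitiveRoot_exp p hp.ne_zero
  refine ⟨AddChar.zmodChar p hprim.pow_eq_one, fun h => ?_, fun t => rfl⟩
  have := DFunLike.congr_fun h 1
  rw [AddChar.zmodChar_apply, ZMod.val_one, pow_one, AddChar.one_apply] at this
  exact hprim.ne_one hp.one_lt this

theorem lamW_eq_sum_cubic {p k : ℕ} [Fact p.Prime] {F : Type} [Field F] [Fintype F] [DecidableEq F]
    [Algebra (ZMod p) F] (hk : 3 ≤ k) (f g : Fin k → Polynomial F)
    (hg : ∀ i : Fin k, 2 ≤ (i : ℕ) → g i = Polynomial.X ^ 3) (w : Fin k → F)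
    {χ : AddChar (ZMod p) ℂ}
    (hχ : ∀ t, Complex.exp (2 * Real.pi * Complex.I / p) ^ t.val = χ t) :
    lamW p F hk f g w = ∑ u : F, (∑ x : F, χ (Algebra.trace (ZMod p) F
      ((∑ i ∈ Finset.univ.filter (fun i : Fin k => 2 ≤ (i : ℕ)), (f i).eval u * w i) * x ^ 3 +
        (w ⟨0, by omega⟩ + u * w ⟨1, by omega⟩) * x))) - Fintype.card F := by
  have hterm : ∀ a u : F, Complex.exp (2 * Real.pi * Complex.I / p) ^
      (Algebra.trace (ZMod p) F
        (a * w ⟨0, by omega⟩ + a * u * w ⟨1, by omega⟩ +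
          ∑ i ∈ Finset.univ.filter (fun i : Fin k => 2 ≤ (i : ℕ)),
            (g i).eval a * (f i).eval u * w i)).val =
      χ (Algebra.trace (ZMod p) F
        ((∑ i ∈ Finset.univ.filter (fun i : Fin k => 2 ≤ (i : ℕ)), (f i).eval u * w i) * a ^ 3 +
          (w ⟨0, by omega⟩ + u * w ⟨1, by omega⟩) * a)) := by
    intro a u
    rw [hχ, Finset.sum_mul, Finset.sum_congr rfl
      (g := fun i => (f i).eval u * w i * a ^ 3) fun i hi => by
        rw [hg i (Finset.mem_filter.1 hi).2, Polynomial.eval_pow, Polynomial.eval_X]; ring]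
    congr 2
    ring
  rw [lamW, Finset.sum_congr rfl fun a _ => Finset.sum_congr rfl fun u _ => hterm a u,
    Finset.sum_comm, eq_sub_iff_add_eq, ← Finset.card_univ, Finset.cast_card,
    ← Finset.sum_add_distrib]
  refine Finset.sum_congr rfl fun u _ => ?_
  rw [Finset.filter_ne', ← Finset.sum_erase_add _ _ (Finset.mem_univ (0 : F))]
  simp

open scoped Classical in
/-- for `q ≡ 2 (mod 3)` odd and `g_i(X) = X³`, every `λ_w` either equals
`q(T_w − 1)` or is a real number at most `(q − T_w)·M_q`; moreover `M_q ≤ 2√q`. -/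
theorem stmt_10 (p e q k : ℕ) (hp : p.Prime) (he : 1 ≤ e) (hq : q = p ^ e) (hk : 3 ≤ k)
    (hqodd : Odd q) (hq3 : q % 3 = 2)
    (F : Type) [Field F] [Fintype F] [DecidableEq F] [Algebra (ZMod p) F]
    (hcard : Fintype.card F = q)
    (f g : Fin k → Polynomial F)
    (hdegf : ∀ i : Fin k, 2 ≤ (i : ℕ) → (f i).natDegree ≤ q - 1)
    (hg : ∀ i : Fin k, 2 ≤ (i : ℕ) → g i = Polynomial.X ^ 3)
    (Mq : ℝ)
    (hMq : IsGreatest {r : ℝ | ∃ a b : F, a ≠ 0 ∧ b ≠ 0 ∧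
      expSum p F (Polynomial.C a * Polynomial.X ^ 3 + Polynomial.C b * Polynomial.X) = (r : ℂ)}
      Mq) :
    (∀ w : Fin k → F,
      lamW p F hk f g w = (q : ℂ) *
          (((Finset.univ.filter (fun u : F =>
              (∑ i ∈ Finset.univ.filter (fun i : Fin k => 2 ≤ (i : ℕ)),
                (f i).eval u * w i) = 0)).card : ℂ) - 1) ∨
      ∃ r : ℝ, lamW p F hk f g w = (r : ℂ) ∧
        r ≤ ((q : ℝ) - ((Finset.univ.filter (fun u : F =>
              (∑ i ∈ Finset.univ.filter (fun i : Fin k => 2 ≤ (i : ℕ)),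
                (f i).eval u * w i) = 0)).card : ℝ)) * Mq) ∧
    Mq ≤ 2 * Real.sqrt q := by
  have : Fact p.Prime := ⟨hp⟩
  obtain ⟨χ, hχ, hexp⟩ := exists_addChar_zmod_eq_exp_pow hp
  have hp2 : p ≠ 2 := by
    rintro rfl
    rw [hq] at hqodd
    exact Nat.not_even_iff_odd.2 hqodd (Nat.even_pow.2 ⟨even_two, by omega⟩)
  have hp3 : p ≠ 3 := by
    rintro rfl
    have : 3 ∣ q := hq ▸ dvd_pow_self 3 (by omega)
    omega
  have hsum : ∀ a b : F,
      expSum p F (Polynomial.C a * Polynomial.X ^ 3 + Polynomial.C b * Polynomial.X) =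
      ∑ x : F, χ (Algebra.trace (ZMod p) F (a * x ^ 3 + b * x)) := fun a b => by
    simp [expSum, hexp]
  have hM : ∀ a b : F, a ≠ 0 → b ≠ 0 →
      (∑ x : F, χ (Algebra.trace (ZMod p) F (a * x ^ 3 + b * x))).re ≤ Mq := fun a b ha hb =>
    hMq.2 ⟨a, b, ha, hb, by rw [hsum]; exact sum_addChar_cubic_eq_re χ a b⟩
  obtain ⟨a₀, b₀, ha₀, -, hab⟩ := hMq.1
  rw [hsum] at hab
  have hweil : |Mq| ≤ 2 * √(Fintype.card F) := by
    have := norm_sum_addChar_cubic_le_two_mul_sqrt hp2 hp3 hχ F ha₀ b₀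
    rwa [hab, Complex.norm_real, Real.norm_eq_abs] at this
  have htriv : |Mq| ≤ Fintype.card F := by
    have := norm_sum_le Finset.univ
      fun x : F => χ (Algebra.trace (ZMod p) F (a₀ * x ^ 3 + b₀ * x))
    rw [hab, Complex.norm_real, Real.norm_eq_abs] at this
    simpa only [AddChar.norm_apply, Finset.sum_const, nsmul_eq_mul, mul_one, Finset.card_univ]
      using this
  subst hcard
  refine ⟨fun w => ?_, (le_abs_self _).trans hweil⟩
  rw [lamW_eq_sum_cubic hk f g hg w hexp]
  by_cases hw : w ⟨0, by omega⟩ = 0 ∧ w ⟨1, by omega⟩ = 0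
  · left
    have hpt : ∀ c : F, ∑ x : F, χ (Algebra.trace (ZMod p) F (c * x ^ 3)) =
        if c = 0 then (Fintype.card F : ℂ) else 0 := fun c => by
      split_ifs with hc
      · simp [hc]
      · exact sum_addChar_cube_eq_zero hq3 hχ hc
    simp only [hw.1, hw.2, mul_zero, add_zero, zero_mul, hpt]
    rw [← Finset.sum_filter, Finset.sum_const, nsmul_eq_mul]
    ring
  · right
    have hle := sum_re_sum_addChar_cubic_le hq3 hχ (abs_le.1 htriv).1 hM
      (fun u => ∑ i ∈ Finset.univ.filter (fun i : Fin k => 2 ≤ (i : ℕ)), (f i).eval u * w i) hw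
    refine ⟨_ - Fintype.card F, ?_, sub_le_iff_le_add.2 hle⟩
    rw [Finset.sum_congr rfl fun u _ => sum_addChar_cubic_eq_re χ _ _]
    push_cast
    rfl
end

section
/- Let q be an odd prime power with q ≡ 2 (mod 3), and let 4 ≤ k ≤ q+1. Let g_i(X) = X^3 and f_i(X) = X^{i−1} for each 3 ≤ i ≤ k. Then S(k,q) is connected and λ_2(S(k,q)) = max{ q(k−3), (q−1)·M_q }; moreover M_q ≤ 2√q. -/
/-- The list of eigenvalues (with multiplicity) of a Hermitian real matrix,
sorted in increasing order. -/
noncomputable def eigSorted {V : Type} [Fintype V] [DecidableEq V] {A : Matrix V V ℝ}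
    (hA : A.IsHermitian) : List ℝ :=
  (Finset.univ.val.map hA.eigenvalues).sort (· ≤ ·)

/-- The second largest eigenvalue (with multiplicity) of a Hermitian real matrix on at least
two indices: the entry at position `card V - 2` of the increasingly sorted list of its
`card V` eigenvalues. -/
noncomputable def secondLargestEig {V : Type} [Fintype V] [DecidableEq V] {A : Matrix V V ℝ}
    (hA : A.IsHermitian) : ℝ :=
  (eigSorted hA).getD (Fintype.card V - 2) 0

/-- A linear combination of Hahn series of pairwise distinct orders has order at most the order
of each series occurring in it with nonzero coefficient. -/
theorem HahnSeries.orderTop_sum_smul_le {K ι : Type*} [Field K] (S : Finset ι)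
    (e : ι → HahnSeries ℤ K) (o : ι → ℤ) (ho : ∀ s ∈ S, (e s).orderTop = o s)
    (hinj : Set.InjOn o S) (c : ι → K) {s₀ : ι} (hs₀ : s₀ ∈ S) (hc : c s₀ ≠ 0) :
    (∑ s ∈ S, c s • e s).orderTop ≤ o s₀ := by
  classical
  obtain ⟨s₁, hs₁, hmin⟩ := Finset.exists_min_image (S.filter fun s => c s ≠ 0) o
    ⟨s₀, by simp [hs₀, hc]⟩
  rw [Finset.mem_filter] at hs₁
  have hle : o s₁ ≤ o s₀ := hmin s₀ (by simp [hs₀, hc])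
  refine le_trans (HahnSeries.orderTop_le_of_coeff_ne_zero (g := o s₁) ?_) (by exact_mod_cast hle)
  rw [HahnSeries.coeff_sum, Finset.sum_eq_single_of_mem s₁ hs₁.1]
  · rw [HahnSeries.coeff_smul, smul_eq_mul]
    exact mul_ne_zero hs₁.2 (HahnSeries.coeff_orderTop_ne (ho s₁ hs₁.1))
  · intro s hs hne
    rw [HahnSeries.coeff_smul, smul_eq_mul]
    by_cases hcs : c s = 0
    · simp [hcs]
    · have h1 : o s₁ ≤ o s := hmin s (by simp [hs, hcs])
      have h2 : o s₁ ≠ o s := fun h => hne (hinj hs hs₁.1 h.symm)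
      rw [HahnSeries.coeff_eq_zero_of_lt_orderTop, mul_zero]
      rw [ho s hs]
      exact_mod_cast lt_of_le_of_ne h1 h2

theorem HahnSeries.orderTop_pow_of_orderTop_eq {K : Type*} [Field K] {x : HahnSeries ℤ K} {m : ℤ}
    (hx : x.orderTop = m) (n : ℕ) : (x ^ n).orderTop = ((n * m : ℤ) : WithTop ℤ) := by
  induction n with
  | zero => simp [HahnSeries.orderTop_one]
  | succ n ih =>
    rw [pow_succ, HahnSeries.orderTop_mul, ih, hx, ← WithTop.coe_add]
    congr 1
    push_cast
    ring

/-- Over a field in which `3 ≠ 0`, the place at infinity of the curve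
`y ^ q - y = x ^ 3 + b x - δ` gives a point over the Laurent series with pole orders `q` and `3`. -/
theorem exists_laurentSeries_point {K : Type*} [Field K] (h3 : (3 : K) ≠ 0) {q : ℕ} (hq : 2 ≤ q)
    (b δ : K) : ∃ x y : HahnSeries ℤ K, x.orderTop = ((-q : ℤ) : WithTop ℤ) ∧
      y.orderTop = ((-3 : ℤ) : WithTop ℤ) ∧
      y ^ q - y = x ^ 3 + HahnSeries.C b * x - HahnSeries.C δ := by
  open PowerSeries in
  obtain ⟨z, hz, hz1⟩ : ∃ z : PowerSeries K,
      z ^ 3 + (C b * X ^ (2 * q)) * z = 1 - X ^ (3 * q - 3) + C δ * X ^ (3 * q) ∧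
        z - 1 ∈ Ideal.span {(X : PowerSeries K)} := by
    let I : Ideal (PowerSeries K) := Ideal.span {X}
    let P : Polynomial (PowerSeries K) := Polynomial.X ^ 3 +
      (Polynomial.C (C b * X ^ (2 * q)) * Polynomial.X -
        Polynomial.C (1 - X ^ (3 * q - 3) + C δ * X ^ (3 * q)))
    have hmon : P.Monic := by
      apply Polynomial.monic_X_pow_add
      refine lt_of_le_of_lt (Polynomial.degree_sub_le _ _) ?_
      refine max_lt ?_ ?_
      · exact lt_of_le_of_lt (Polynomial.degree_C_mul_X_le _) (by norm_num)
      · exact lt_of_le_of_lt Polynomial.degree_C_le (by norm_num)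
    have hI : ∀ n : ℕ, n ≠ 0 → (X : PowerSeries K) ^ n ∈ I := fun n hn =>
      Ideal.pow_mem_of_mem _ (Ideal.mem_span_singleton_self _) _ (Nat.pos_of_ne_zero hn)
    obtain ⟨z, hz, hz1⟩ := HenselianRing.is_henselian (I := I) P hmon 1 (by
      have : P.eval 1 = C b * X ^ (2 * q) + (X ^ (3 * q - 3) - C δ * X ^ (3 * q)) := by
        simp [P]; ring
      rw [this]
      exact I.add_mem (I.mul_mem_left _ (hI _ (by omega)))
        (I.sub_mem (hI _ (by omega)) (I.mul_mem_left _ (hI _ (by omega))))) (by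
      have : P.derivative.eval 1 = C 3 + C b * X ^ (2 * q) := by
        simp only [P, Polynomial.derivative_add, Polynomial.derivative_sub,
          Polynomial.derivative_C_mul, Polynomial.derivative_X, Polynomial.derivative_C,
          Polynomial.derivative_X_pow, Polynomial.eval_add, Polynomial.eval_mul,
          Polynomial.eval_C, Polynomial.eval_pow, Polynomial.eval_X, map_ofNat]
        simp
      rw [this, map_add, Ideal.Quotient.eq_zero_iff_mem.mpr
        (I.mul_mem_left _ (hI _ (by omega))), add_zero]
      exact ((isUnit_iff_ne_zero.mpr h3).map C).map _)
    refine ⟨z, ?_, hz1⟩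
    have := hz.eq_zero
    simp only [P, Polynomial.eval_add, Polynomial.eval_sub, Polynomial.eval_pow,
      Polynomial.eval_X, Polynomial.eval_mul, Polynomial.eval_C] at this
    linear_combination this
  let Z : HahnSeries ℤ K := HahnSeries.ofPowerSeries ℤ K z
  have hZ0 : Z.orderTop = ((0 : ℤ) : WithTop ℤ) := by
    have hc : PowerSeries.constantCoeff z = 1 := by
      rw [Ideal.mem_span_singleton, PowerSeries.X_dvd_iff, map_sub, map_one, sub_eq_zero] at hz1
      exact hz1
    refine HahnSeries.orderTop_eq_of_le (g := 0) ?_ ?_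
    · have := HahnSeries.ofPowerSeries_apply_coeff (Γ := ℤ) z 0
      simp only [Nat.cast_zero] at this
      rw [HahnSeries.mem_support, this]
      simp [hc]
    · intro g hg
      by_contra hlt
      push Not at hlt
      apply hg
      change (HahnSeries.ofPowerSeries ℤ K z).coeff g = 0
      rw [HahnSeries.ofPowerSeries_apply, HahnSeries.embDomain_of_notMem_range]
      rintro ⟨n, hn⟩
      simp at hn
      omega
  refine ⟨HahnSeries.single (-q : ℤ) 1 * Z, HahnSeries.single (-3 : ℤ) 1, ?_, ?_, ?_⟩
  · rw [HahnSeries.orderTop_mul, hZ0, HahnSeries.orderTop_single one_ne_zero]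
    simp
  · rw [HahnSeries.orderTop_single one_ne_zero]
  · have hZ : Z ^ 3 + HahnSeries.C b * HahnSeries.single ((2 * q : ℕ) : ℤ) 1 * Z =
        1 - HahnSeries.single ((3 * q - 3 : ℕ) : ℤ) 1 +
          HahnSeries.C δ * HahnSeries.single ((3 * q : ℕ) : ℤ) 1 := by
      have := congrArg (HahnSeries.ofPowerSeries ℤ K) hz
      simpa only [map_add, map_mul, map_sub, map_one, HahnSeries.ofPowerSeries_X_pow,
        HahnSeries.ofPowerSeries_C, map_pow (HahnSeries.ofPowerSeries ℤ K) z] using this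
    have h1 : (HahnSeries.single (-3 : ℤ) (1 : K)) ^ q = HahnSeries.single (-(3 * q) : ℤ) 1 := by
      rw [HahnSeries.single_pow]; simp; ring_nf
    have h2 : (HahnSeries.single (-q : ℤ) (1 : K)) ^ 3 = HahnSeries.single (-(3 * q) : ℤ) 1 := by
      rw [HahnSeries.single_pow]; simp
    have h4 : (HahnSeries.single (-q : ℤ) (1 : K)) =
        HahnSeries.single (-(3 * q) : ℤ) 1 * HahnSeries.single ((2 * q : ℕ) : ℤ) 1 := by
      rw [HahnSeries.single_mul_single, one_mul]
      congr 2
      push_cast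
      ring
    have h5 : (HahnSeries.single (-3 : ℤ) (1 : K)) =
        HahnSeries.single (-(3 * q) : ℤ) 1 * HahnSeries.single ((3 * q - 3 : ℕ) : ℤ) 1 := by
      rw [HahnSeries.single_mul_single, one_mul]
      congr 2
      omega
    have h6 : (1 : HahnSeries ℤ K) =
        HahnSeries.single (-(3 * q) : ℤ) 1 * HahnSeries.single ((3 * q : ℕ) : ℤ) 1 := by
      rw [HahnSeries.single_mul_single, one_mul]
      push_cast
      rw [neg_add_cancel]; rfl
    rw [mul_pow, h1, h2]
    rw [h4, h5]
    linear_combination (-HahnSeries.single (-(3 * q) : ℤ) (1:K)) * hZ + HahnSeries.C δ * h6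

/-- Evaluation of a bivariate polynomial at a point `(x, y)` over an extension. -/
noncomputable def bivariateEval {K S : Type*} [CommRing K] [CommRing S] (φ : K →+* S) (x y : S) :
    Polynomial (Polynomial K) →+* S :=
  Polynomial.eval₂RingHom (Polynomial.eval₂RingHom φ x) y

/-- The polynomial `Y ^ q - Y - (X ^ 3 + b X - δ)` as a polynomial in `Y`. -/
noncomputable def artinSchreierCubic {K : Type*} [CommRing K] (q : ℕ) (b δ : K) :
    Polynomial (Polynomial K) :=
  Polynomial.X ^ q - (Polynomial.X + Polynomial.C (Polynomial.X ^ 3 +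
    Polynomial.C b * Polynomial.X - Polynomial.C δ))

section ArtinSchreierCubic

variable {K S : Type*} [Field K] [CommRing S] {q : ℕ} {b δ : K}

theorem bivariateEval_artinSchreierCubic (φ : K →+* S) {x y : S}
    (h : y ^ q - y = x ^ 3 + φ b * x - φ δ) :
    bivariateEval φ x y (artinSchreierCubic q b δ) = 0 := by
  simp only [bivariateEval, artinSchreierCubic, map_sub, map_add, map_pow, map_mul,
    Polynomial.coe_eval₂RingHom, Polynomial.eval₂_X, Polynomial.eval₂_C]
  linear_combination h

theorem artinSchreierCubic_degree_aux (hq : 2 ≤ q) :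
    (Polynomial.X + Polynomial.C (Polynomial.X ^ 3 + Polynomial.C b * Polynomial.X -
      Polynomial.C δ) : Polynomial (Polynomial K)).degree < q := by
  rw [Polynomial.degree_X_add_C]
  exact_mod_cast (by omega : 1 < q)

theorem monic_artinSchreierCubic (hq : 2 ≤ q) : (artinSchreierCubic q b δ).Monic :=
  Polynomial.monic_X_pow_sub (n := q) (artinSchreierCubic_degree_aux hq)

theorem natDegree_artinSchreierCubic (hq : 2 ≤ q) : (artinSchreierCubic q b δ).natDegree = q := by
  rw [artinSchreierCubic, Polynomial.natDegree_sub_eq_left_of_natDegree_lt,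
    Polynomial.natDegree_X_pow]
  rw [Polynomial.natDegree_X_add_C, Polynomial.natDegree_X_pow]
  omega

theorem bivariateEval_modByMonic (φ : K →+* S) {x y : S}
    (h : y ^ q - y = x ^ 3 + φ b * x - φ δ) (G : Polynomial (Polynomial K)) :
    bivariateEval φ x y (G %ₘ artinSchreierCubic q b δ) = bivariateEval φ x y G := by
  conv_rhs => rw [← Polynomial.modByMonic_add_div G (artinSchreierCubic q b δ)]
  rw [map_add, map_mul, bivariateEval_artinSchreierCubic φ h, zero_mul, add_zero]

theorem bivariateEval_modByMonic_hahnSeries {x y : HahnSeries ℤ K}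
    (hxy : y ^ q - y = x ^ 3 + HahnSeries.C b * x - HahnSeries.C δ)
    (G : Polynomial (Polynomial K)) :
    bivariateEval HahnSeries.C x y (G %ₘ artinSchreierCubic q b δ) =
      bivariateEval HahnSeries.C x y G := by
  have := bivariateEval_modByMonic (S := HahnSeries ℤ K) (q := q) (b := b) (δ := δ) (x := x)
    (y := y) HahnSeries.C (by convert hxy) G
  exact this

/-- A polynomial of `Y`-degree less than `q` has at the place at infinity a pole of order at least
the weight of each of its monomials. -/
theorem orderTop_bivariateEval_le (hq3 : Nat.Coprime q 3) {x y : HahnSeries ℤ K}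
    (hx : x.orderTop = ((-q : ℤ) : WithTop ℤ)) (hy : y.orderTop = ((-3 : ℤ) : WithTop ℤ))
    {G : Polynomial (Polynomial K)} (hG : G.natDegree < q) {i j : ℕ}
    (hij : (G.coeff j).coeff i ≠ 0) :
    (bivariateEval HahnSeries.C x y G).orderTop ≤ ((-(q * i + 3 * j) : ℤ) : WithTop ℤ) := by
  obtain ⟨N, hN⟩ : ∃ N, ∀ j ∈ Finset.range q, (G.coeff j).natDegree < N := by
    refine ⟨(Finset.range q).sup (fun j => (G.coeff j).natDegree) + 1, fun j hj => ?_⟩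
    exact Nat.lt_succ_of_le (Finset.le_sup (f := fun j => (G.coeff j).natDegree) hj)
  have hjq : j < q := by
    refine lt_of_le_of_lt (Polynomial.le_natDegree_of_ne_zero ?_) hG
    rintro h
    simp [h] at hij
  have hiN : i < N :=
    lt_of_le_of_lt (Polynomial.le_natDegree_of_ne_zero hij) (hN j (Finset.mem_range.mpr hjq))
  have hsum : bivariateEval HahnSeries.C x y G =
      ∑ s ∈ Finset.range q ×ˢ Finset.range N, (G.coeff s.1).coeff s.2 • (x ^ s.2 * y ^ s.1) := by
    rw [Finset.sum_product, bivariateEval, Polynomial.coe_eval₂RingHom,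
      Polynomial.eval₂_eq_sum_range' _ hG]
    refine Finset.sum_congr rfl fun j hj => ?_
    rw [Polynomial.coe_eval₂RingHom, Polynomial.eval₂_eq_sum_range' _ (hN j hj), Finset.sum_mul]
    refine Finset.sum_congr rfl fun i _ => ?_
    rw [mul_assoc, HahnSeries.C_mul_eq_smul]
  rw [hsum]
  refine HahnSeries.orderTop_sum_smul_le (Finset.range q ×ˢ Finset.range N) _
    (fun s => (-(q * s.2 + 3 * s.1) : ℤ)) ?_ ?_
    (fun s : ℕ × ℕ => (G.coeff s.1).coeff s.2) (s₀ := (j, i)) (by simp [hjq, hiN]) hij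
  · intro s _
    rw [HahnSeries.orderTop_mul, HahnSeries.orderTop_pow_of_orderTop_eq hx,
      HahnSeries.orderTop_pow_of_orderTop_eq hy, ← WithTop.coe_add]
    congr 1
    ring
  · rintro ⟨j₁, i₁⟩ h₁ ⟨j₂, i₂⟩ h₂ h
    simp only [Finset.coe_product, Finset.coe_range, Set.mem_prod, Set.mem_Iio] at h₁ h₂
    simp only [neg_inj] at h
    have hnat : q * i₁ + 3 * j₁ = q * i₂ + 3 * j₂ := by exact_mod_cast h
    have hmod : j₁ ≡ j₂ [MOD q] := by
      refine Nat.ModEq.cancel_left_of_coprime (c := 3) hq3 ?_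
      have := congrArg (· % q) hnat
      simpa [Nat.ModEq, Nat.add_mod] using this
    have hj : j₁ = j₂ := by
      rw [Nat.ModEq, Nat.mod_eq_of_lt h₁.1, Nat.mod_eq_of_lt h₂.1] at hmod
      exact hmod
    subst hj
    have hq0 : 0 < q := by omega
    have : i₁ = i₂ := Nat.eq_of_mul_eq_mul_left hq0 (by omega)
    rw [this]

end ArtinSchreierCubic

theorem exists_mul_add_three_mul_eq {q n : ℕ} (hq3 : Nat.Coprime q 3) (hn : 3 * q ≤ n) :
    ∃ i j : ℕ, q * i + 3 * j = n := by
  have h : q % 3 = 1 ∨ q % 3 = 2 := by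
    have h0 : q % 3 ≠ 0 := fun h => by
      have := Nat.eq_one_of_dvd_coprimes hq3 (Nat.dvd_of_mod_eq_zero h) dvd_rfl
      omega
    omega
  have h3 : n % 3 = 0 ∨ n % 3 = 1 ∨ n % 3 = 2 := by omega
  rcases h3 with h3 | h3 | h3
  · exact ⟨0, n / 3, by omega⟩
  · rcases h with h | h
    · exact ⟨1, (n - q) / 3, by omega⟩
    · exact ⟨2, (n - q * 2) / 3, by omega⟩
  · rcases h with h | h
    · exact ⟨2, (n - q * 2) / 3, by omega⟩
    · exact ⟨1, (n - q) / 3, by omega⟩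

/-- The auxiliary polynomial of Stepanov's method: a polynomial with a controlled pole at infinity
which vanishes at all rational points of the curve `y ^ q - y = x ^ 3 + b x - δ`. -/
theorem exists_stepanov_polynomial {K : Type*} [Field K] [Fintype K] {p s q r : ℕ}
    [Fact p.Prime] [CharP K p] (hr : r = p ^ s) (hK : Fintype.card K = r ^ 2) (hq : 2 ≤ q)
    (hq3 : Nat.Coprime q 3) (hbig : 9 * q ^ 2 + 9 * q + 1 < r) (b δ : K) {x y : HahnSeries ℤ K}
    (hx : x.orderTop = ((-q : ℤ) : WithTop ℤ)) (hy : y.orderTop = ((-3 : ℤ) : WithTop ℤ))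
    (hxy : y ^ q - y = x ^ 3 + HahnSeries.C b * x - HahnSeries.C δ) :
    ∃ H : Polynomial (Polynomial K), bivariateEval HahnSeries.C x y H ≠ 0 ∧
      ((-(r ^ 2 + (6 * q + 1) * r) : ℤ) : WithTop ℤ) ≤
        (bivariateEval HahnSeries.C x y H).orderTop ∧
      ∀ x₀ y₀ : K, y₀ ^ q - y₀ = x₀ ^ 3 + b * x₀ - δ →
        bivariateEval (RingHom.id K) x₀ y₀ H = 0 := by
  classical
  choose! u w huw using fun n => exists_mul_add_three_mul_eq (q := q) (n := n) hq3
  let M : ℕ → Polynomial (Polynomial K) := fun n =>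
    Polynomial.C (Polynomial.X) ^ u n * Polynomial.X ^ w n
  have hM : ∀ n, 3 * q ≤ n →
      (bivariateEval HahnSeries.C x y (M n)).orderTop = ((-n : ℤ) : WithTop ℤ) := by
    intro n hn
    have : bivariateEval HahnSeries.C x y (M n) = x ^ u n * y ^ w n := by
      simp only [M, map_mul, map_pow]
      simp [bivariateEval]
    rw [this, HahnSeries.orderTop_mul, HahnSeries.orderTop_pow_of_orderTop_eq hx,
      HahnSeries.orderTop_pow_of_orderTop_eq hy, ← WithTop.coe_add]
    congr 1
    have := huw n hn
    zify at this
    linarith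
  let ι := ↥(Finset.Ico (3 * q) r ×ˢ Finset.Ico (3 * q) (r + 6 * q + 1))
  have hι : ∀ t : ι, (3 * q ≤ t.1.1 ∧ t.1.1 < r) ∧ (3 * q ≤ t.1.2 ∧ t.1.2 < r + 6 * q + 1) := by
    intro t
    have h := Finset.mem_product.mp t.2
    rwa [Finset.mem_Ico, Finset.mem_Ico] at h
  obtain ⟨W, hW⟩ : ∃ W, W = r ^ 2 + 6 * q := ⟨_, rfl⟩
  have hsub : ∀ a a' : K, (a - a') ^ r = a ^ r - a' ^ r := fun a a' => by
    rw [hr, sub_pow_char_pow]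
  have hsum : ∀ (A : Finset ι) (v : ι → K), (∑ t ∈ A, v t) ^ r = ∑ t ∈ A, v t ^ r := fun A v => by
    simp only [hr, sum_pow_char_pow]
  have hr3 : 3 * q < r := by nlinarith
  have hcardι : W + 1 < Fintype.card ι := by
    rw [Fintype.card_coe, Finset.card_product, Nat.card_Ico, Nat.card_Ico]
    obtain ⟨d, rfl⟩ := Nat.exists_eq_add_of_lt hr3
    have h1 : 3 * q + d + 1 - 3 * q = d + 1 := by omega
    have h2 : 3 * q + d + 1 + 6 * q + 1 - 3 * q = d + 6 * q + 2 := by omega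
    rw [h1, h2]
    rw [hW]
    nlinarith
  let G : (ι → K) → Polynomial (Polynomial K) := fun c =>
    ∑ t : ι, Polynomial.C (Polynomial.C (c t ^ r)) * (M t.1.1 ^ r * M t.1.2)
  let H : (ι → K) → Polynomial (Polynomial K) := fun c =>
    ∑ t : ι, Polynomial.C (Polynomial.C (c t)) * (M t.1.1 * M t.1.2 ^ r)
  have hCC : ∀ a : K, bivariateEval HahnSeries.C x y (Polynomial.C (Polynomial.C a)) =
      HahnSeries.C a := by
    intro a
    simp [bivariateEval]
  have hev : ∀ (c : ι → K) (P : ι → Polynomial (Polynomial K)),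
      bivariateEval HahnSeries.C x y (∑ t, Polynomial.C (Polynomial.C (c t)) * P t) =
        ∑ t, c t • bivariateEval HahnSeries.C x y (P t) := by
    intro c P
    rw [map_sum]
    refine Finset.sum_congr rfl fun t _ => ?_
    rw [map_mul, hCC, HahnSeries.C_mul_eq_smul]
  have hr0 : r ≠ 0 := by omega
  -- a nonzero choice of coefficients for which the polar part of `G c` vanishes
  obtain ⟨c, hc0, hcG⟩ : ∃ c : ι → K, c ≠ 0 ∧
      ∀ k : Fin (W + 1), (bivariateEval HahnSeries.C x y (G c)).coeff (-(k : ℕ) : ℤ) = 0 := by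
    obtain ⟨c₁, c₂, hne, heq⟩ := Fintype.exists_ne_map_eq_of_card_lt
      (fun (c : ι → K) (k : Fin (W + 1)) =>
        (bivariateEval HahnSeries.C x y (G c)).coeff (-(k : ℕ) : ℤ)) (by
        simp only [Fintype.card_fun, Fintype.card_fin]
        exact Nat.pow_lt_pow_right Fintype.one_lt_card hcardι)
    refine ⟨c₁ - c₂, sub_ne_zero.mpr hne, fun k => ?_⟩
    have hG : G (c₁ - c₂) = G c₁ - G c₂ := by
      simp only [G, ← Finset.sum_sub_distrib]
      refine Finset.sum_congr rfl fun t _ => ?_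
      rw [← sub_mul, ← map_sub, ← map_sub, Pi.sub_apply, hsub]
    rw [hG, map_sub, HahnSeries.coeff_sub, sub_eq_zero]
    exact congrFun heq k
  have hGmod : G c %ₘ artinSchreierCubic q b δ = 0 := by
    by_contra hne
    obtain ⟨j, hj⟩ : ∃ j, (G c %ₘ artinSchreierCubic q b δ).coeff j ≠ 0 := by
      by_contra! h
      exact hne (Polynomial.ext (by simpa using h))
    obtain ⟨i, hi⟩ : ∃ i, ((G c %ₘ artinSchreierCubic q b δ).coeff j).coeff i ≠ 0 := by
      by_contra! h
      exact hj (Polynomial.ext (by simpa using h))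
    have hdeg : (G c %ₘ artinSchreierCubic q b δ).natDegree < q := by
      have h := Polynomial.natDegree_modByMonic_lt (G c)
        (monic_artinSchreierCubic (b := b) (δ := δ) hq) (by
          intro h1
          have := natDegree_artinSchreierCubic (b := b) (δ := δ) hq
          rw [h1, Polynomial.natDegree_one] at this
          omega)
      rwa [natDegree_artinSchreierCubic hq] at h
    have hle := orderTop_bivariateEval_le hq3 hx hy hdeg hi
    rw [bivariateEval_modByMonic_hahnSeries hxy] at hle
    have hge : ((-W : ℤ) : WithTop ℤ) ≤ (bivariateEval HahnSeries.C x y (G c)).orderTop := by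
      rw [hev, ← HahnSeries.addVal_apply]
      refine AddValuation.map_le_sum _ fun t _ => ?_
      rw [HahnSeries.addVal_apply]
      refine le_trans ?_ (HahnSeries.orderTop_le_orderTop_smul _ _)
      obtain ⟨⟨h1, h2⟩, h3, h4⟩ := hι t
      rw [map_mul, map_pow, HahnSeries.orderTop_mul,
        HahnSeries.orderTop_pow_of_orderTop_eq (hM _ h1), hM _ h3, ← WithTop.coe_add,
        WithTop.coe_le_coe]
      have h5 : r * t.1.1 + t.1.2 ≤ W := by
        have h6 : r * t.1.1 ≤ r * (r - 1) := Nat.mul_le_mul_left _ (by omega)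
        have h7 : r * (r - 1) + r = r ^ 2 := by
          obtain ⟨d, rfl⟩ := Nat.exists_eq_succ_of_ne_zero hr0
          simp only [Nat.succ_eq_add_one, Nat.add_sub_cancel]
          ring
        omega
      zify at h5
      linarith
    obtain ⟨o, ho⟩ := WithTop.ne_top_iff_exists.mp (ne_top_of_le_ne_top WithTop.coe_ne_top hle)
    rw [← ho, WithTop.coe_le_coe] at hle hge
    refine HahnSeries.coeff_orderTop_ne ho.symm ?_
    have hij : (0 : ℤ) ≤ q * i + 3 * j := by positivity
    have := hcG ⟨(-o).toNat, by omega⟩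
    rwa [show (-((-o).toNat : ℕ) : ℤ) = o by omega] at this
  refine ⟨H c, ?_, ?_, ?_⟩
  · obtain ⟨t₀, ht₀⟩ := Function.ne_iff.mp hc0
    have hle : (bivariateEval HahnSeries.C x y (H c)).orderTop ≤
        ((-(t₀.1.1 + r * t₀.1.2) : ℤ) : WithTop ℤ) := by
      rw [hev]
      refine HahnSeries.orderTop_sum_smul_le Finset.univ _
        (fun t : ι => (-(t.1.1 + r * t.1.2) : ℤ)) ?_ ?_ c (Finset.mem_univ t₀) ht₀
      · intro t _
        obtain ⟨⟨h1, h2⟩, h3, h4⟩ := hι t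
        rw [map_mul, map_pow, HahnSeries.orderTop_mul, hM _ h1,
          HahnSeries.orderTop_pow_of_orderTop_eq (hM _ h3), ← WithTop.coe_add]
        congr 1
        ring
      · intro t₁ _ t₂ _ h
        simp only [neg_inj] at h
        have h' : t₁.1.1 + r * t₁.1.2 = t₂.1.1 + r * t₂.1.2 := by exact_mod_cast h
        have e1 : t₁.1.1 = t₂.1.1 := by
          have := congrArg (· % r) h'
          simpa [Nat.add_mul_mod_self_left, Nat.mod_eq_of_lt (hι t₁).1.2,
            Nat.mod_eq_of_lt (hι t₂).1.2] using this
        have e2 : t₁.1.2 = t₂.1.2 :=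
          Nat.eq_of_mul_eq_mul_left (Nat.pos_of_ne_zero hr0) (by omega)
        exact Subtype.ext (Prod.ext e1 e2)
    intro h0
    rw [h0, HahnSeries.orderTop_zero] at hle
    exact WithTop.coe_ne_top (top_le_iff.mp hle)
  · rw [hev, ← HahnSeries.addVal_apply]
    refine AddValuation.map_le_sum _ fun t _ => ?_
    rw [HahnSeries.addVal_apply]
    refine le_trans ?_ (HahnSeries.orderTop_le_orderTop_smul _ _)
    obtain ⟨⟨h1, h2⟩, h3, h4⟩ := hι t
    rw [map_mul, map_pow, HahnSeries.orderTop_mul, hM _ h1,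
      HahnSeries.orderTop_pow_of_orderTop_eq (hM _ h3), ← WithTop.coe_add, WithTop.coe_le_coe]
    have h5 : t.1.1 + r * t.1.2 ≤ r ^ 2 + (6 * q + 1) * r := by
      have h6 : r * t.1.2 ≤ r * (r + 6 * q) := Nat.mul_le_mul_left _ (by omega)
      nlinarith
    zify at h5
    linarith
  · intro x₀ y₀ h
    have hG0 : bivariateEval (RingHom.id K) x₀ y₀ (G c) = 0 := by
      rw [← bivariateEval_modByMonic (RingHom.id K) (b := b) (δ := δ) h, hGmod, map_zero]
    refine eq_zero_of_pow_eq_zero (n := r) ?_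
    rw [← hG0]
    simp only [H, G, map_sum]
    rw [hsum]
    refine Finset.sum_congr rfl fun t _ => ?_
    have hCC' : ∀ a : K, bivariateEval (RingHom.id K) x₀ y₀ (Polynomial.C (Polynomial.C a)) =
        a := by
      intro a
      simp [bivariateEval]
    simp only [map_mul, map_pow, hCC', mul_pow]
    rw [← pow_mul (bivariateEval (RingHom.id K) x₀ y₀ (M t.1.2)), ← pow_two, ← hK,
      FiniteField.pow_card]

/-- Stepanov's bound for the number of `x` such that `x ^ 3 + b x - δ` is of the form
`y ^ q - y`. -/
theorem card_artinSchreierCubic_le {K : Type*} [Field K] [Fintype K] {p s m q r : ℕ}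
    [Fact p.Prime] [CharP K p] (hr : r = p ^ s) (hK : Fintype.card K = r ^ 2) (hqp : q = p ^ m)
    (hq : 2 ≤ q) (hq3 : Nat.Coprime q 3) (hbig : 9 * q ^ 2 + 9 * q + 1 < r)
    {T : Finset K} (hT : T.card = q) (hTq : ∀ c ∈ T, c ^ q = c) (h3 : (3 : K) ≠ 0) (b δ : K)
    (Z : Finset K) (hZ : ∀ x ∈ Z, ∃ y, y ^ q - y = x ^ 3 + b * x - δ) :
    q * Z.card ≤ r ^ 2 + (6 * q + 1) * r := by
  classical
  obtain ⟨x, y, hx, hy, hxy⟩ := exists_laurentSeries_point h3 hq b δ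
  obtain ⟨H, hH0, hHo, hHv⟩ := exists_stepanov_polynomial hr hK hq hq3 hbig b δ hx hy hxy
  set H' := H %ₘ artinSchreierCubic q b δ with hH'
  have hevH' : bivariateEval HahnSeries.C x y H' = bivariateEval HahnSeries.C x y H :=
    bivariateEval_modByMonic_hahnSeries hxy H
  have hdeg : H'.natDegree < q := by
    have h := Polynomial.natDegree_modByMonic_lt H
      (monic_artinSchreierCubic (b := b) (δ := δ) hq) (by
        intro h1
        have := natDegree_artinSchreierCubic (b := b) (δ := δ) hq
        rw [h1, Polynomial.natDegree_one] at this
        omega)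
    rwa [natDegree_artinSchreierCubic hq] at h
  have hne : H' ≠ 0 := by
    intro h
    rw [h, map_zero] at hevH'
    exact hH0 hevH'.symm
  obtain ⟨j, hj⟩ : ∃ j, H'.coeff j ≠ 0 := by
    by_contra! h
    exact hne (Polynomial.ext (by simpa using h))
  have hle := orderTop_bivariateEval_le hq3 hx hy hdeg (j := j)
    (i := (H'.coeff j).natDegree) (by simpa using hj)
  rw [hevH'] at hle
  have hle' := hHo.trans hle
  rw [WithTop.coe_le_coe] at hle'
  have hdegle : q * (H'.coeff j).natDegree ≤ r ^ 2 + (6 * q + 1) * r := by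
    zify
    have : (0 : ℤ) ≤ 3 * j := by positivity
    linarith
  have hroots : Z.card ≤ (H'.coeff j).natDegree := by
    refine Polynomial.card_le_degree_of_subset_roots ?_
    intro x₀ hx₀
    obtain ⟨y₀, hy₀⟩ := hZ x₀ hx₀
    rw [Polynomial.mem_roots hj, Polynomial.IsRoot.def]
    have hzero : H'.map (Polynomial.evalRingHom x₀) = 0 := by
      refine Polynomial.eq_zero_of_natDegree_lt_card_of_eval_eq_zero' _
        (T.image fun c => y₀ + c) ?_ ?_
      · intro y₁ hy₁
        obtain ⟨c, hc, rfl⟩ := Finset.mem_image.mp hy₁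
        have hpt : (y₀ + c) ^ q - (y₀ + c) = x₀ ^ 3 + b * x₀ - δ := by
          rw [← hy₀, hqp, add_pow_char_pow, ← hqp, hTq c hc]
          ring
        have h1 := hHv x₀ (y₀ + c) hpt
        rw [← bivariateEval_modByMonic (RingHom.id K) (b := b) (δ := δ) hpt, ← hH'] at h1
        rw [Polynomial.eval_map]
        exact h1
      · rw [Finset.card_image_of_injective _ (add_right_injective y₀), hT]
        exact lt_of_le_of_lt Polynomial.natDegree_map_le hdeg
    have := congrArg (fun P => Polynomial.coeff P j) hzero
    simpa using this
  exact (Nat.mul_le_mul_left q hroots).trans hdegle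

/-- The complete exponential sum of the cubic `x ^ 3 + b x` is `O(√|K|)`. -/
theorem norm_sum_addChar_cubic_le_s11 {K : Type*} [Field K] [Fintype K] {p s m q r : ℕ}
    [Fact p.Prime] [CharP K p] (hr : r = p ^ s) (hK : Fintype.card K = r ^ 2) (hqp : q = p ^ m)
    (hq : 2 ≤ q) (hq3 : Nat.Coprime q 3) (hbig : 9 * q ^ 2 + 9 * q + 1 < r)
    {T : Finset K} (hT : T.card = q) (hTq : ∀ c ∈ T, c ^ q = c) (h3 : (3 : K) ≠ 0) (b : K)
    {Ψ : AddChar K ℂ} (hΨ : Ψ ≠ 1) (hΨq : ∀ y, Ψ (y ^ q) = Ψ y) :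
    ‖∑ x, Ψ (x ^ 3 + b * x)‖ ≤ (6 * q + 1) * r := by
  classical
  let h : K × K → K := fun z => z.1 ^ 3 + b * z.1 - (z.2 ^ q - z.2)
  let N : K → ℕ := fun δ => (Finset.univ.filter fun z => h z = δ).card
  have hN : ∀ δ, N δ ≤ r ^ 2 + (6 * q + 1) * r := by
    intro δ
    let Z : Finset K := Finset.univ.filter fun x => ∃ y, y ^ q - y = x ^ 3 + b * x - δ
    refine le_trans ?_ (card_artinSchreierCubic_le hr hK hqp hq hq3 hbig hT hTq h3 b δ Z
      (fun x hx => (Finset.mem_filter.mp hx).2))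
    refine Finset.card_le_mul_card_image_of_maps_to (f := Prod.fst) (t := Z) ?_ q ?_
    · intro z hz
      refine Finset.mem_filter.mpr ⟨Finset.mem_univ _, z.2, ?_⟩
      have := (Finset.mem_filter.mp hz).2
      simp only [h] at this
      linear_combination -this
    · intro x _
      have hdeg : (Polynomial.X ^ q - (Polynomial.X + Polynomial.C (x ^ 3 + b * x - δ)) :
          Polynomial K).natDegree = q := by
        rw [Polynomial.natDegree_sub_eq_left_of_natDegree_lt, Polynomial.natDegree_X_pow]
        rw [Polynomial.natDegree_X_add_C, Polynomial.natDegree_X_pow]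
        omega
      have hne : (Polynomial.X ^ q - (Polynomial.X + Polynomial.C (x ^ 3 + b * x - δ)) :
          Polynomial K) ≠ 0 := by
        intro h0
        rw [h0, Polynomial.natDegree_zero] at hdeg
        omega
      rw [← Finset.card_image_of_injOn (f := Prod.snd)]
      · conv_rhs => rw [← hdeg]
        refine Polynomial.card_le_degree_of_subset_roots fun y hy => ?_
        obtain ⟨z, hz, rfl⟩ := Finset.mem_image.mp (Finset.mem_val.mp hy)
        obtain ⟨hz1, rfl⟩ := Finset.mem_filter.mp hz
        have hz2 := (Finset.mem_filter.mp hz1).2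
        rw [Polynomial.mem_roots hne]
        simp only [Polynomial.IsRoot.def, Polynomial.eval_sub, Polynomial.eval_pow,
          Polynomial.eval_X, Polynomial.eval_add, Polynomial.eval_C]
        simp only [h] at hz2
        linear_combination -hz2
      · intro z hz z' hz' heq
        have e1 := (Finset.mem_filter.mp hz).2
        have e2 := (Finset.mem_filter.mp hz').2
        exact Prod.ext (e1.trans e2.symm) heq
  have hcard : ∑ δ, N δ = (r ^ 2) ^ 2 := by
    have h1 := Finset.card_eq_sum_card_fiberwise (f := h) (s := Finset.univ) (t := Finset.univ)
      (fun _ _ => Finset.mem_coe.mpr (Finset.mem_univ _))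
    rw [Finset.card_univ, Fintype.card_prod, hK] at h1
    rw [sq, h1]
  have hPsi : ∀ z : K × K, Ψ (h z) = Ψ (z.1 ^ 3 + b * z.1) := by
    intro z
    simp only [h]
    have h0 : Ψ z.2 ≠ 0 := norm_ne_zero_iff.mp (by rw [AddChar.norm_apply]; exact one_ne_zero)
    rw [AddChar.map_sub_eq_div, AddChar.map_sub_eq_div, hΨq, div_self h0, div_one]
  have hsum : ∑ δ, (N δ : ℂ) * Ψ δ = r ^ 2 * ∑ x, Ψ (x ^ 3 + b * x) := by
    have h1 : ∑ z : K × K, Ψ (h z) = r ^ 2 * ∑ x, Ψ (x ^ 3 + b * x) := by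
      simp only [hPsi]
      rw [Fintype.sum_prod_type, Finset.mul_sum]
      refine Finset.sum_congr rfl fun x _ => ?_
      simp [hK]
    rw [← h1, ← Finset.sum_fiberwise Finset.univ h]
    refine Finset.sum_congr rfl fun δ _ => ?_
    rw [Finset.sum_congr rfl (fun z hz => by rw [(Finset.mem_filter.mp hz).2] :
      ∀ z ∈ Finset.univ.filter (fun z => h z = δ), Ψ (h z) = Ψ δ)]
    simp [N]
  have hr0 : (0 : ℝ) < r := by
    have : 0 < r := by omega
    exact_mod_cast this
  have hb : ‖∑ δ, (N δ : ℂ) * Ψ δ‖ ≤ r ^ 2 * ((6 * q + 1) * r) := by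
    have h2 : ∑ δ, (N δ : ℂ) * Ψ δ =
        ∑ δ, ((N δ : ℂ) - (r ^ 2 + (6 * q + 1) * r)) * Ψ δ := by
      simp only [sub_mul, Finset.sum_sub_distrib, ← Finset.mul_sum,
        AddChar.sum_eq_zero_of_ne_one hΨ, mul_zero, sub_zero]
    rw [h2]
    refine (norm_sum_le _ _).trans ?_
    have h3 : ∀ δ, ‖((N δ : ℂ) - (r ^ 2 + (6 * q + 1) * r)) * Ψ δ‖ =
        (r ^ 2 + (6 * q + 1) * r) - N δ := by
      intro δ
      rw [norm_mul, AddChar.norm_apply, mul_one, norm_sub_rev]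
      have : ((r : ℂ) ^ 2 + (6 * q + 1) * r) - N δ =
          (((r ^ 2 + (6 * q + 1) * r - N δ : ℝ)) : ℂ) := by push_cast; ring
      rw [this, Complex.norm_real, Real.norm_of_nonneg]
      have := hN δ
      rify at this
      linarith
    simp only [h3]
    rw [Finset.sum_sub_distrib]
    have h4 : ∑ δ, (N δ : ℝ) = (r ^ 2) ^ 2 := by exact_mod_cast hcard
    rw [h4]
    simp only [Finset.sum_const, Finset.card_univ, hK, nsmul_eq_mul]
    push_cast
    apply le_of_eq
    ring
  rw [hsum, norm_mul] at hb
  have h5 : ‖(r : ℂ) ^ 2‖ = r ^ 2 := by simp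
  rw [h5] at hb
  exact le_of_mul_le_mul_left hb (by positivity)

/-- Squares and a fixed nonsquare times squares together cover every element twice. -/
theorem sum_sq_add_sum_nonsquare_mul_sq {K : Type*} [Field K] [Fintype K] [DecidableEq K]
    (hK : ringChar K ≠ 2) {d : K} (hd : ¬ IsSquare d) (g : K → ℂ) :
    ∑ v, g (v ^ 2) + ∑ v, g (d * v ^ 2) = 2 * ∑ w, g w := by
  have hsq : ∀ g : K → ℂ, ∑ v, g (v ^ 2) = ∑ w, ((quadraticChar K w : ℤ) + 1 : ℂ) * g w := by
    intro g
    rw [← Finset.sum_fiberwise Finset.univ (fun v : K => v ^ 2)]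
    refine Finset.sum_congr rfl fun w _ => ?_
    rw [Finset.sum_congr rfl (fun z hz => by rw [(Finset.mem_filter.mp hz).2] :
      ∀ z ∈ Finset.univ.filter (fun z : K => z ^ 2 = w), g (z ^ 2) = g w)]
    have h := quadraticChar_card_sqrts hK w
    rw [Finset.sum_const, nsmul_eq_mul]
    congr 1
    have h' : ((Finset.univ.filter (fun z : K => z ^ 2 = w)).card : ℤ) = quadraticChar K w + 1 := by
      rw [← h]
      congr 2
      ext
      simp
    exact_mod_cast h'
  have hd0 : d ≠ 0 := by
    rintro rfl
    exact hd IsSquare.zero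
  have hχ : quadraticChar K d = -1 := quadraticChar_neg_one_iff_not_isSquare.mpr hd
  rw [hsq g, hsq (fun w => g (d * w)), ← Equiv.sum_comp (Equiv.mulLeft₀ d hd0)
    (fun w => ((quadraticChar K w : ℤ) + 1 : ℂ) * g w), ← Finset.sum_add_distrib,
    ← Equiv.sum_comp (Equiv.mulLeft₀ d hd0) g, Finset.mul_sum]
  refine Finset.sum_congr rfl fun w _ => ?_
  simp only [Equiv.mulLeft₀_apply, map_mul, hχ]
  push_cast
  ring

/-- A finite field of odd characteristic has a quadratic extension in which the exponential sum of
`x ^ 3 + b x` is determined by that of the base field. -/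
theorem exists_quadratic_extension_sum_cubic {K : Type} [Field K] [Fintype K] {p m q : ℕ}
    [Fact p.Prime] [CharP K p] (hqp : q = p ^ m) (h2 : (2 : K) ≠ 0) (h3 : (3 : K) ≠ 0) (b : K)
    {Ψ : AddChar K ℂ} (hΨ : Ψ ≠ 1) (hΨq : ∀ y, Ψ (y ^ q) = Ψ y) :
    ∃ (L : Type) (_ : Field L) (_ : Fintype L) (_ : K →+* L) (c : L) (Φ : AddChar L ℂ),
      Fintype.card L = Fintype.card K ^ 2 ∧ Φ ≠ 1 ∧ (∀ y, Φ (y ^ q) = Φ y) ∧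
      (∑ x, Ψ (x ^ 3 + b * x)) ^ 2 + ∑ z, Φ (z ^ 3 + c * z) = 2 * Fintype.card K := by
  classical
  have hK : ringChar K ≠ 2 := by
    intro h
    apply h2
    have := ringChar.Nat.cast_ringChar (R := K)
    rw [h] at this
    exact_mod_cast this
  obtain ⟨d, hd⟩ := FiniteField.exists_nonsquare hK
  have : Fact (∀ r : K, r ^ 2 ≠ d + 0 * r) := ⟨fun r h => hd ⟨r, by
    rw [zero_mul, add_zero] at h
    rw [← h, sq]⟩⟩
  let e := QuadraticAlgebra.equivProd d (0 : K)
  let _ : Fintype (QuadraticAlgebra K d 0) := Fintype.ofEquiv _ e.symm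
  let Φ : AddChar (QuadraticAlgebra K d 0) ℂ :=
    Ψ.compAddMonoidHom (QuadraticAlgebra.trace (a := d) (b := (0 : K))).toAddMonoidHom
  have hΦ : ∀ z, Φ z = Ψ (2 * z.re) := by
    intro z
    simp [Φ, QuadraticAlgebra.trace_def]
  refine ⟨QuadraticAlgebra K d 0, inferInstance, inferInstance, algebraMap K _,
    algebraMap K _ b, Φ, ?_, ?_, ?_, ?_⟩
  · rw [Fintype.card_congr e, Fintype.card_prod, sq]
  · obtain ⟨x, hx⟩ := AddChar.ne_one_iff.mp hΨ
    refine AddChar.ne_one_iff.mpr ⟨⟨x / 2, 0⟩, ?_⟩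
    rw [hΦ]
    simpa [mul_div_cancel₀ x h2] using hx
  · intro z
    have : CharP (QuadraticAlgebra K d 0) p :=
      charP_of_injective_algebraMap QuadraticAlgebra.algebraMap_injective p
    have htr : (QuadraticAlgebra.trace (z ^ q) : K) = QuadraticAlgebra.trace z ^ q := by
      apply QuadraticAlgebra.algebraMap_injective (a := d) (b := (0 : K))
      rw [RingHom.map_pow, QuadraticAlgebra.algebraMap_trace_eq_add_star,
        QuadraticAlgebra.algebraMap_trace_eq_add_star, hqp, add_pow_char_pow, star_pow]
    change Ψ (QuadraticAlgebra.trace (z ^ q)) = Ψ (QuadraticAlgebra.trace z)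
    rw [htr, hΨq]
  · have e1 : (∑ x, Ψ (x ^ 3 + b * x)) ^ 2 =
        ∑ u, ∑ v, Ψ (2 * u ^ 3 + 2 * b * u) * Ψ (6 * u * v ^ 2) := by
      rw [sq, Finset.sum_mul_sum, ← Fintype.sum_prod_type', ← Fintype.sum_prod_type']
      let t : K × K → K × K := fun z => (z.1 + z.2, z.1 - z.2)
      have ht : Function.Injective t := by
        rintro ⟨u, v⟩ ⟨u', v'⟩ h
        obtain ⟨ha, hb⟩ := Prod.mk.injEq .. ▸ h
        simp only at ha hb
        have hu : u = u' := mul_left_cancel₀ h2 (by linear_combination ha + hb)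
        have hv : v = v' := mul_left_cancel₀ h2 (by linear_combination ha - hb)
        rw [hu, hv]
      rw [← Function.Bijective.sum_comp (Finite.injective_iff_bijective.mp ht)]
      refine Finset.sum_congr rfl fun z _ => ?_
      rw [← AddChar.map_add_eq_mul, ← AddChar.map_add_eq_mul]
      congr 1
      simp only [t]
      ring
    have e2 : ∑ z, Φ (z ^ 3 + algebraMap K (QuadraticAlgebra K d 0) b * z) =
        ∑ u, ∑ v, Ψ (2 * u ^ 3 + 2 * b * u) * Ψ (6 * u * (d * v ^ 2)) := by
      rw [← Fintype.sum_prod_type', ← Equiv.sum_comp e.symm]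
      refine Finset.sum_congr rfl fun z _ => ?_
      rw [hΦ, ← AddChar.map_add_eq_mul]
      congr 1
      simp [e, pow_succ, QuadraticAlgebra.equivProd]
      ring
    rw [e1, e2, ← Finset.sum_add_distrib]
    have e3 : ∀ u, ∑ v, Ψ (2 * u ^ 3 + 2 * b * u) * Ψ (6 * u * v ^ 2) +
        ∑ v, Ψ (2 * u ^ 3 + 2 * b * u) * Ψ (6 * u * (d * v ^ 2)) =
        if u = 0 then (2 * Fintype.card K : ℂ) else 0 := by
      intro u
      rw [← Finset.mul_sum, ← Finset.mul_sum, ← mul_add,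
        sum_sq_add_sum_nonsquare_mul_sq hK hd (fun w => Ψ (6 * u * w))]
      split_ifs with hu
      · simp [hu]
      · have h6 : (6 * u : K) ≠ 0 := by
          refine mul_ne_zero ?_ hu
          have : (6 : K) = 2 * 3 := by norm_num
          rw [this]
          exact mul_ne_zero h2 h3
        have h7 : ∑ w, Ψ (6 * u * w) = ∑ w, Ψ w := Equiv.sum_comp (Equiv.mulLeft₀ _ h6) Ψ
        rw [h7, AddChar.sum_eq_zero_of_ne_one hΨ]
        simp
    simp only [e3]
    simp

/-- If the Weil bound fails for the exponential sum of `x ^ 3 + b x` over `F`, it fails with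
exponentially growing constants along a tower of quadratic extensions. -/
theorem exists_tower_le_norm_sum_cubic {F : Type} [Field F] [Fintype F] {p m q : ℕ}
    [Fact p.Prime] [CharP F p] (hqp : q = p ^ m) (hF : Fintype.card F = q)
    (h2 : (2 : F) ≠ 0) (h3 : (3 : F) ≠ 0) (b : F) {Ψ : AddChar F ℂ} (hΨ : Ψ ≠ 1) {D : ℝ}
    (hD : 0 ≤ D) (hS : (2 + D) * √q ≤ ‖∑ x, Ψ (x ^ 3 + b * x)‖) (i : ℕ) :
    ∃ (K : Type) (_ : Field K) (_ : Fintype K) (_ : F →+* K) (c : K) (Φ : AddChar K ℂ),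
      Fintype.card K = q ^ 2 ^ i ∧ Φ ≠ 1 ∧ (∀ y, Φ (y ^ q) = Φ y) ∧
      (2 + 4 ^ i * D) * √((q : ℝ) ^ 2 ^ i) ≤ ‖∑ x, Φ (x ^ 3 + c * x)‖ := by
  induction i with
  | zero =>
    refine ⟨F, inferInstance, inferInstance, RingHom.id F, b, Ψ, by simpa using hF, hΨ, ?_, ?_⟩
    · intro y
      rw [← hF, FiniteField.pow_card]
    · simpa using hS
  | succ i ih =>
    obtain ⟨K, _, _, φ, c, Φ, hK, hΦ, hΦq, hle⟩ := ih
    have : CharP K p := charP_of_injective_ringHom φ.injective p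
    have h2' : (2 : K) ≠ 0 := by
      have := (map_ne_zero φ).mpr h2
      rwa [map_ofNat] at this
    have h3' : (3 : K) ≠ 0 := by
      have := (map_ne_zero φ).mpr h3
      rwa [map_ofNat] at this
    obtain ⟨L, _, _, χ, c', Φ', hL, hΦ', hΦq', heq⟩ :=
      exists_quadratic_extension_sum_cubic hqp h2' h3' c hΦ hΦq
    refine ⟨L, inferInstance, inferInstance, χ.comp φ, c', Φ', ?_, hΦ', hΦq', ?_⟩
    · rw [hL, hK, ← pow_mul, pow_succ]
    · set Q : ℝ := (q : ℝ) ^ 2 ^ i with hQ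
      have hQ0 : 0 ≤ Q := by positivity
      have hQ2 : (q : ℝ) ^ 2 ^ (i + 1) = Q ^ 2 := by rw [hQ, ← pow_mul, pow_succ]
      rw [hQ2, Real.sqrt_sq hQ0]
      set S := ∑ x, Φ (x ^ 3 + c * x)
      have e1 : ∑ z, Φ' (z ^ 3 + c' * z) = 2 * Fintype.card K - S ^ 2 := by
        linear_combination heq
      rw [e1, norm_sub_rev]
      have e2 : ‖S ^ 2‖ - ‖(2 * Fintype.card K : ℂ)‖ ≤ ‖S ^ 2 - 2 * Fintype.card K‖ :=
        norm_sub_norm_le _ _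
      have e3 : ‖(2 * Fintype.card K : ℂ)‖ = 2 * Q := by
        rw [hK]
        simp [hQ]
      rw [e3, norm_pow] at e2
      refine le_trans ?_ e2
      have e4 : ((2 + 4 ^ i * D) * √Q) ^ 2 ≤ ‖S‖ ^ 2 :=
        pow_le_pow_left₀ (by positivity) hle 2
      rw [mul_pow, Real.sq_sqrt hQ0] at e4
      have e5 : 0 ≤ (4 ^ i * D) ^ 2 * Q := by positivity
      rw [pow_succ (4 : ℝ)]
      nlinarith

/-- The Weil bound for the exponential sum of `x ^ 3 + b x`. -/
theorem norm_sum_addChar_cubic_le_two_mul_sqrt_s11 {F : Type} [Field F] [Fintype F] {p m q : ℕ}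
    [Fact p.Prime] [CharP F p] (hqp : q = p ^ m) (hF : Fintype.card F = q)
    (h2 : (2 : F) ≠ 0) (h3 : (3 : F) ≠ 0) (hq3 : Nat.Coprime q 3) (b : F) {Ψ : AddChar F ℂ}
    (hΨ : Ψ ≠ 1) : ‖∑ x, Ψ (x ^ 3 + b * x)‖ ≤ 2 * √q := by
  classical
  by_contra! hlt
  have hq2 : 2 ≤ q := by
    rw [← hF]
    exact Fintype.one_lt_card
  have hq0 : (0 : ℝ) < q := by
    exact_mod_cast (by omega : 0 < q)
  have hs : 0 < √(q : ℝ) := Real.sqrt_pos.mpr hq0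
  set D : ℝ := ‖∑ x, Ψ (x ^ 3 + b * x)‖ / √q - 2 with hDdef
  have hD : 0 < D := by
    rw [hDdef, sub_pos, lt_div_iff₀ hs]
    exact hlt
  have hS : (2 + D) * √q ≤ ‖∑ x, Ψ (x ^ 3 + b * x)‖ := by
    rw [hDdef, add_sub_cancel, div_mul_cancel₀ _ hs.ne']
  obtain ⟨n, hn⟩ := exists_nat_gt ((6 * q + 1) / D)
  obtain ⟨i, hni, hi⟩ : ∃ i, n ≤ i ∧ 9 * q ^ 2 + 9 * q + 1 ≤ i :=
    ⟨max n (9 * q ^ 2 + 9 * q + 1), le_max_left _ _, le_max_right _ _⟩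
  obtain ⟨K, _, _, φ, c, Φ, hK, hΦ, hΦq, hle⟩ :=
    exists_tower_le_norm_sum_cubic hqp hF h2 h3 b hΨ hD.le hS (i + 1)
  have : CharP K p := charP_of_injective_ringHom φ.injective p
  have h3' : (3 : K) ≠ 0 := by
    have := (map_ne_zero φ).mpr h3
    rwa [map_ofNat] at this
  have hbig : 9 * q ^ 2 + 9 * q + 1 < q ^ 2 ^ i := by
    have h4 : i < 2 ^ i := Nat.lt_two_pow_self
    have h5 : 2 ^ i < q ^ 2 ^ i := Nat.lt_pow_self (by omega)
    omega
  have hup := norm_sum_addChar_cubic_le_s11 (r := q ^ 2 ^ i) (s := m * 2 ^ i) (by rw [hqp, pow_mul])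
    (by rw [hK, ← pow_mul, pow_succ]) hqp hq2 hq3 hbig (T := Finset.univ.image φ)
    (by rw [Finset.card_image_of_injective _ φ.injective, Finset.card_univ, hF])
    (by
      intro c hc
      obtain ⟨a, _, rfl⟩ := Finset.mem_image.mp hc
      rw [← map_pow, ← hF, FiniteField.pow_card]) h3' c hΦ hΦq
  have h := hle.trans hup
  have hQ : √((q : ℝ) ^ 2 ^ (i + 1)) = (q : ℝ) ^ 2 ^ i := by
    rw [pow_succ 2 i, pow_mul, Real.sqrt_sq (by positivity)]
  rw [hQ, Nat.cast_pow] at h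
  have h' := le_of_mul_le_mul_right h (by positivity)
  rw [div_lt_iff₀ hD] at hn
  have h6 : (n : ℝ) ≤ 4 ^ (i + 1) := by
    have : n ≤ 4 ^ (i + 1) := by
      have : i + 1 < 4 ^ (i + 1) := Nat.lt_pow_self (by norm_num)
      omega
    exact_mod_cast this
  nlinarith [mul_le_mul_of_nonneg_right h6 hD.le]

/-- The eigenvalues of a Hermitian matrix can be read off a complex diagonalization. -/
theorem Matrix.IsHermitian.map_eigenvalues_eq_of_mul_eq {V : Type*} [Fintype V] [DecidableEq V]
    {A : Matrix V V ℝ} (hA : A.IsHermitian) {U : Matrix V V ℂ} (hU : IsUnit U) {μ : V → ℝ}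
    (h : A.map Complex.ofRealHom * U = U * Matrix.diagonal fun w => (μ w : ℂ)) :
    Finset.univ.val.map hA.eigenvalues = Finset.univ.val.map μ := by
  obtain ⟨u, rfl⟩ := hU
  have h1 : A.charpoly.map Complex.ofRealHom =
      (∏ w, (Polynomial.X - Polynomial.C (μ w))).map Complex.ofRealHom := by
    rw [← Matrix.charpoly_map, ← Matrix.charpoly_units_conj' u, mul_assoc, h, ← mul_assoc,
      ← Matrix.coe_units_inv, Units.inv_mul, one_mul, Matrix.charpoly_diagonal,
      Polynomial.map_prod]
    simp
  have h2 := congrArg Polynomial.roots (Polynomial.map_injective _ Complex.ofRealHom.injective h1)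
  rw [hA.roots_charpoly_eq_eigenvalues, Polynomial.roots_prod _ _
    (Finset.prod_ne_zero_iff.mpr fun w _ => Polynomial.X_sub_C_ne_zero _)] at h2
  simpa using h2

/-- The next-to-last entry of a sorted list whose two largest entries are known. -/
theorem Multiset.sort_cons_cons_getD {a b : ℝ} {t : Multiset ℝ} (hab : b ≤ a)
    (ht : ∀ x ∈ t, x ≤ b) :
    ((a ::ₘ b ::ₘ t).sort (· ≤ ·)).getD (Multiset.card (a ::ₘ b ::ₘ t) - 2) 0 = b := by
  have h : (a ::ₘ b ::ₘ t).sort (· ≤ ·) = t.sort (· ≤ ·) ++ [b, a] := by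
    refine List.Perm.eq_of_pairwise' (r := (· ≤ ·)) (Multiset.pairwise_sort _ _) ?_ ?_
    · rw [List.pairwise_append]
      refine ⟨Multiset.pairwise_sort _ _, by simpa using hab, ?_⟩
      intro x hx y hy
      have hx' := ht x ((Multiset.mem_sort _).mp hx)
      simp only [List.mem_cons, List.not_mem_nil, or_false] at hy
      rcases hy with rfl | rfl
      · exact hx'
      · exact hx'.trans hab
    · rw [← Multiset.coe_eq_coe, Multiset.sort_eq, ← Multiset.coe_add, Multiset.sort_eq]
      change a ::ₘ b ::ₘ t = t + (b ::ₘ a ::ₘ 0)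
      rw [Multiset.add_cons, Multiset.add_cons, add_zero, Multiset.cons_swap]
  rw [h]
  simp

section PiCharacters

variable {F : Type*} [Field F] [Fintype F] {ι : Type*} [Fintype ι] [DecidableEq ι]
  {ψ : AddChar F ℂ}

theorem sum_addChar_dotProduct [DecidableEq (ι → F)] (hψ : ψ ≠ 1) (a : ι → F) :
    ∑ w : ι → F, ψ (a ⬝ᵥ w) = if a = 0 then (Fintype.card (ι → F) : ℂ) else 0 := by
  split_ifs with ha
  · simp [ha]
  · let Φ : AddChar (ι → F) ℂ :=
      ψ.compAddMonoidHom (AddMonoidHom.mk' (fun w => a ⬝ᵥ w) (dotProduct_add a))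
    have hΦ : Φ ≠ 1 := by
      obtain ⟨i, hi⟩ := Function.ne_iff.mp ha
      obtain ⟨x, hx⟩ := AddChar.ne_one_iff.mp hψ
      refine AddChar.ne_one_iff.mpr ⟨Pi.single i (x / a i), ?_⟩
      simpa [Φ, mul_div_cancel₀ x hi] using hx
    exact AddChar.sum_eq_zero_of_ne_one hΦ

theorem isUnit_addChar_dotProduct [DecidableEq (ι → F)] (hψ : ψ ≠ 1) :
    IsUnit (Matrix.of fun a w : ι → F => ψ (a ⬝ᵥ w)) := by
  refine (Matrix.isUnit_iff_isUnit_det _).mpr (Matrix.isUnit_det_of_right_inverse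
    (B := (Fintype.card (ι → F) : ℂ)⁻¹ • Matrix.of fun w a : ι → F => ψ (-(a ⬝ᵥ w))) ?_)
  ext a b
  rw [Matrix.mul_smul, Matrix.smul_apply, Matrix.mul_apply]
  have : ∀ w, (Matrix.of fun a w : ι → F => ψ (a ⬝ᵥ w)) a w *
      (Matrix.of fun w a : ι → F => ψ (-(a ⬝ᵥ w))) w b = ψ ((a - b) ⬝ᵥ w) := by
    intro w
    simp only [Matrix.of_apply]
    rw [← AddChar.map_add_eq_mul, sub_dotProduct, sub_eq_add_neg]
  simp only [this]
  rw [sum_addChar_dotProduct hψ, Matrix.one_apply]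
  simp only [sub_eq_zero]
  split_ifs <;> simp

variable [DecidableEq F] {G : SimpleGraph (ι → F)} [DecidableRel G.Adj] {C : Finset (ι → F)}
  {lam : (ι → F) → ℝ}

theorem sum_adj_addChar_dotProduct (hG : ∀ a b, G.Adj a b ↔ b - a ∈ C)
    (hlam : ∀ w, ∑ c ∈ C, ψ (c ⬝ᵥ w) = lam w) (a w : ι → F) :
    ∑ b, (if G.Adj a b then ψ (b ⬝ᵥ w) else 0) = ψ (a ⬝ᵥ w) * lam w := by
  rw [← hlam, Finset.mul_sum, ← Equiv.sum_comp (Equiv.addLeft a)]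
  simp only [hG, Equiv.coe_addLeft, add_sub_cancel_left, add_dotProduct, AddChar.map_add_eq_mul]
  rw [Finset.sum_ite_mem, Finset.univ_inter]

/-- The spectrum of a Cayley graph on `F ^ ι`. -/
theorem map_eigenvalues_cayley (hψ : ψ ≠ 1) (hG : ∀ a b, G.Adj a b ↔ b - a ∈ C)
    (hlam : ∀ w, ∑ c ∈ C, ψ (c ⬝ᵥ w) = lam w) (hA : (G.adjMatrix ℝ).IsHermitian) :
    Finset.univ.val.map hA.eigenvalues = Finset.univ.val.map lam := by
  refine hA.map_eigenvalues_eq_of_mul_eq (isUnit_addChar_dotProduct hψ) ?_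
  ext a w
  rw [Matrix.mul_diagonal, Matrix.of_apply, ← sum_adj_addChar_dotProduct hG hlam,
    Matrix.mul_apply]
  refine Finset.sum_congr rfl fun b _ => ?_
  simp [SimpleGraph.adjMatrix_apply]

/-- A Cayley graph on `F ^ ι` whose degree is a simple eigenvalue is connected. -/
theorem connected_cayley (hψ : ψ ≠ 1) (hG : ∀ a b, G.Adj a b ↔ b - a ∈ C)
    (hlam : ∀ w, ∑ c ∈ C, ψ (c ⬝ᵥ w) = lam w) (hne : ∀ w, w ≠ 0 → lam w ≠ C.card) :
    G.Connected := by
  classical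
  refine (SimpleGraph.connected_iff_exists_forall_reachable G).mpr ⟨0, ?_⟩
  let f : (ι → F) → ℂ := fun a => if G.Reachable 0 a then 1 else 0
  have hadj : ∀ a b, G.Adj a b → f a = f b := by
    intro a b hab
    have : G.Reachable 0 a ↔ G.Reachable 0 b :=
      ⟨fun h => h.trans hab.reachable, fun h => h.trans hab.symm.reachable⟩
    simp only [f, this]
  have hdeg : ∀ a, ∑ b, (if G.Adj a b then (1 : ℂ) else 0) = C.card := by
    intro a
    rw [← Equiv.sum_comp (Equiv.addLeft a)]
    simp [hG]
  have hhat : ∀ w, w ≠ 0 → ∑ a, f a * ψ (a ⬝ᵥ w) = 0 := by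
    intro w hw
    have h1 : ∑ a, ∑ b, (if G.Adj a b then f a * ψ (b ⬝ᵥ w) else 0) =
        lam w * ∑ a, f a * ψ (a ⬝ᵥ w) := by
      rw [Finset.mul_sum]
      refine Finset.sum_congr rfl fun a _ => ?_
      have := sum_adj_addChar_dotProduct hG hlam a w
      rw [mul_left_comm, mul_comm (lam w : ℂ), ← this, Finset.mul_sum]
      refine Finset.sum_congr rfl fun b _ => ?_
      rw [mul_ite, mul_zero]
    have h2 : ∑ a, ∑ b, (if G.Adj a b then f a * ψ (b ⬝ᵥ w) else 0) =
        C.card * ∑ a, f a * ψ (a ⬝ᵥ w) := by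
      rw [Finset.sum_comm, Finset.mul_sum]
      refine Finset.sum_congr rfl fun b _ => ?_
      rw [← hdeg b, Finset.sum_mul]
      refine Finset.sum_congr rfl fun a _ => ?_
      by_cases h : G.Adj a b
      · rw [if_pos h, if_pos h.symm, hadj a b h, one_mul]
      · rw [if_neg h, if_neg (fun h' => h h'.symm), zero_mul]
    have h3 : ((lam w : ℂ) - C.card) * ∑ a, f a * ψ (a ⬝ᵥ w) = 0 := by
      rw [sub_mul, ← h1, ← h2, sub_self]
    refine (mul_eq_zero.mp h3).resolve_left ?_
    exact sub_ne_zero.mpr (by exact_mod_cast hne w hw)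
  have hinv : ∀ x, ∑ w : ι → F, (∑ a, f a * ψ (a ⬝ᵥ w)) * ψ (-(x ⬝ᵥ w)) =
      Fintype.card (ι → F) * f x := by
    intro x
    simp only [Finset.sum_mul]
    rw [Finset.sum_comm]
    have : ∀ a, ∑ w : ι → F, f a * ψ (a ⬝ᵥ w) * ψ (-(x ⬝ᵥ w)) =
        if a = x then (Fintype.card (ι → F) : ℂ) * f x else 0 := by
      intro a
      have h4 : ∀ w : ι → F, f a * ψ (a ⬝ᵥ w) * ψ (-(x ⬝ᵥ w)) = f a * ψ ((a - x) ⬝ᵥ w) := by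
        intro w
        rw [mul_assoc, ← AddChar.map_add_eq_mul, sub_dotProduct, sub_eq_add_neg]
      simp only [h4, ← Finset.mul_sum]
      rw [sum_addChar_dotProduct hψ]
      simp only [sub_eq_zero]
      split_ifs with h
      · rw [h, mul_comm]
      · rw [mul_zero]
    simp only [this]
    simp
  have hconst : ∀ x, (Fintype.card (ι → F) : ℂ) * f x = ∑ a, f a := by
    intro x
    rw [← hinv x, Finset.sum_eq_single 0]
    · simp
    · intro w _ hw
      rw [hhat w hw, zero_mul]
    · simp
  intro x
  have h0 : (Fintype.card (ι → F) : ℂ) ≠ 0 := by exact_mod_cast Fintype.card_ne_zero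
  have h5 : f x = f 0 := mul_left_cancel₀ h0 ((hconst x).trans (hconst 0).symm)
  by_contra hx
  simp [f, hx] at h5

end PiCharacters

section CubicPencil

variable {F : Type*} [Field F] [Fintype F] {q n : ℕ} {ε : F → F → ℝ} {M : ℝ}

theorem sum_cubicPencil_zero [DecidableEq F] (h00 : ε 0 0 = q) (h1 : ∀ a, a ≠ 0 → ε a 0 = 0)
    (P : Polynomial F) :
    ∑ u, ε (u ^ 2 * P.eval u) 0 - q =
      q * ((Finset.univ.filter fun u : F => u ≠ 0 ∧ P.eval u = 0).card : ℝ) := by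
  have h : ∀ u, ε (u ^ 2 * P.eval u) 0 = (if u = 0 then (q : ℝ) else 0) +
      q * (if u ≠ 0 ∧ P.eval u = 0 then 1 else 0) := by
    intro u
    by_cases hu : u = 0
    · simp [hu, h00]
    · by_cases hP : P.eval u = 0
      · simp [hu, hP, h00]
      · simp [hu, hP, h1]
  simp only [h]
  rw [Finset.sum_add_distrib, ← Finset.mul_sum, Finset.sum_boole]
  simp

/-- The nontrivial eigenvalues are at most `max (q (n - 1)) ((q - 1) M)`. -/
theorem sum_cubicPencil_le (hF : Fintype.card F = q) (h00 : ε 0 0 = q)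
    (h0 : ∀ b, b ≠ 0 → ε 0 b = 0) (h1 : ∀ a, a ≠ 0 → ε a 0 = 0)
    (hM : ∀ a b, a ≠ 0 → b ≠ 0 → ε a b ≤ M) (hM0 : 0 ≤ M) {P : Polynomial F}
    (hP : P.natDegree < n) {l₀ l₁ : F} (hne : ¬ (P = 0 ∧ l₀ = 0 ∧ l₁ = 0)) :
    ∑ u, ε (u ^ 2 * P.eval u) (l₀ + l₁ * u) - q ≤ max (q * ((n : ℝ) - 1)) ((q - 1) * M) := by
  classical
  by_cases hl : l₀ = 0 ∧ l₁ = 0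
  · have hP0 : P ≠ 0 := fun h => hne ⟨h, hl⟩
    refine le_max_of_le_left ?_
    simp only [hl.1, hl.2, zero_mul, add_zero]
    rw [sum_cubicPencil_zero h00 h1]
    refine mul_le_mul_of_nonneg_left ?_ (Nat.cast_nonneg q)
    have hc : (Finset.univ.filter fun u : F => u ≠ 0 ∧ P.eval u = 0).card ≤ P.natDegree := by
      refine Polynomial.card_le_degree_of_subset_roots fun u hu => ?_
      rw [Polynomial.mem_roots hP0]
      exact (Finset.mem_filter.mp (Finset.mem_val.mp hu)).2.2
    have hc' : (Finset.univ.filter fun u : F => u ≠ 0 ∧ P.eval u = 0).card + 1 ≤ n := by omega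
    rw [le_sub_iff_add_le]
    exact_mod_cast hc'
  · refine le_max_of_le_right ?_
    have hle : ∀ u, ε (u ^ 2 * P.eval u) (l₀ + l₁ * u) ≤
        (M - if u = 0 then M else 0) + if l₀ + l₁ * u = 0 then (q : ℝ) else 0 := by
      intro u
      have hm : 0 ≤ M - if u = 0 then M else 0 := by split_ifs <;> simp [hM0]
      by_cases hL : l₀ + l₁ * u = 0
      · rw [if_pos hL, hL]
        by_cases hA : u ^ 2 * P.eval u = 0
        · rw [hA, h00]
          linarith
        · rw [h1 _ hA]
          positivity
      · rw [if_neg hL, add_zero]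
        by_cases hA : u ^ 2 * P.eval u = 0
        · rw [hA, h0 _ hL]
          exact hm
        · have hu : u ≠ 0 := by
            rintro rfl
            simp at hA
          rw [if_neg hu, sub_zero]
          exact hM _ _ hA hL
    have hc : (Finset.univ.filter fun u : F => l₀ + l₁ * u = 0).card ≤ 1 := by
      refine Finset.card_le_one.mpr fun u hu v hv => ?_
      have eu := (Finset.mem_filter.mp hu).2
      have ev := (Finset.mem_filter.mp hv).2
      by_cases h : l₁ = 0
      · rw [h, zero_mul, add_zero] at eu
        exact absurd ⟨eu, h⟩ hl
      · exact mul_left_cancel₀ h (by linear_combination eu - ev)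
    have hs := Finset.sum_le_sum fun u (_ : u ∈ Finset.univ) => hle u
    rw [Finset.sum_add_distrib, Finset.sum_sub_distrib, Finset.sum_const, Finset.card_univ, hF,
      Finset.sum_ite_eq' Finset.univ (0 : F), if_pos (Finset.mem_univ _), ← Finset.sum_filter,
      Finset.sum_const, nsmul_eq_mul, nsmul_eq_mul] at hs
    have hc' : ((Finset.univ.filter fun u : F => l₀ + l₁ * u = 0).card : ℝ) ≤ 1 := by
      exact_mod_cast hc
    have hq0 : (0 : ℝ) ≤ q := Nat.cast_nonneg q
    nlinarith [mul_le_mul_of_nonneg_right hc' hq0]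

/-- The bound of `sum_cubicPencil_le` is attained. -/
theorem exists_sum_cubicPencil_eq (hF : Fintype.card F = q) (h00 : ε 0 0 = q)
    (h1 : ∀ a, a ≠ 0 → ε a 0 = 0) (hscale : ∀ a b u, u ≠ 0 → ε (a * u ^ 3) (b * u) = ε a b)
    (hM : ∃ a b, a ≠ 0 ∧ b ≠ 0 ∧ ε a b = M) (hn : 2 ≤ n) (hnq : n ≤ q) :
    ∃ (P : Polynomial F) (l₀ l₁ : F), P.natDegree < n ∧ ¬ (P = 0 ∧ l₀ = 0 ∧ l₁ = 0) ∧
      ∑ u, ε (u ^ 2 * P.eval u) (l₀ + l₁ * u) - q = max (q * ((n : ℝ) - 1)) ((q - 1) * M) := by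
  classical
  rcases le_total ((q - 1) * M) (q * ((n : ℝ) - 1)) with h | h
  · rw [max_eq_left h]
    obtain ⟨S, hS, hSc⟩ := Finset.exists_subset_card_eq
      (s := Finset.univ.erase (0 : F)) (n := n - 1) (by
        rw [Finset.card_erase_of_mem (Finset.mem_univ _), Finset.card_univ, hF]
        omega)
    have hprod : (∏ s ∈ S, (Polynomial.X - Polynomial.C s)).natDegree = n - 1 := by
      rw [Polynomial.natDegree_prod_of_monic _ _ fun s _ => Polynomial.monic_X_sub_C s]
      simp [hSc]
    refine ⟨∏ s ∈ S, (Polynomial.X - Polynomial.C s), 0, 0, ?_, ?_, ?_⟩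
    · omega
    · intro h
      exact (Polynomial.monic_prod_of_monic _ _ fun s _ => Polynomial.monic_X_sub_C s).ne_zero h.1
    · simp only [zero_mul, add_zero]
      rw [sum_cubicPencil_zero h00 h1]
      have : (Finset.univ.filter fun u : F => u ≠ 0 ∧
          (∏ s ∈ S, (Polynomial.X - Polynomial.C s)).eval u = 0) = S := by
        ext u
        simp only [Finset.mem_filter, Finset.mem_univ, true_and, Polynomial.eval_prod,
          Finset.prod_eq_zero_iff, Polynomial.eval_sub, Polynomial.eval_X, Polynomial.eval_C,
          sub_eq_zero]
        constructor
        · rintro ⟨_, s, hs, rfl⟩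
          exact hs
        · intro hu
          exact ⟨(Finset.mem_erase.mp (hS hu)).1, u, hu, rfl⟩
      rw [this, hSc, Nat.cast_sub (by omega), Nat.cast_one]
  · rw [max_eq_right h]
    obtain ⟨a, b, ha, hb, hab⟩ := hM
    refine ⟨Polynomial.C a * Polynomial.X, 0, b, ?_, fun h => hb h.2.2, ?_⟩
    · rw [Polynomial.natDegree_C_mul_X a ha]
      omega
    · have he : ∀ u, ε (u ^ 2 * (Polynomial.C a * Polynomial.X).eval u) (0 + b * u) =
          M + if u = 0 then q - M else 0 := by
        intro u
        have e1 : u ^ 2 * (Polynomial.C a * Polynomial.X).eval u = a * u ^ 3 := by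
          simp only [Polynomial.eval_mul, Polynomial.eval_C, Polynomial.eval_X]
          ring
        rw [e1, zero_add]
        split_ifs with hu
        · simp [hu, h00]
        · rw [hscale a b u hu, hab, add_zero]
      simp only [he]
      rw [Finset.sum_add_distrib, Finset.sum_const, Finset.card_univ, hF,
        Finset.sum_ite_eq' Finset.univ (0 : F), if_pos (Finset.mem_univ _), nsmul_eq_mul]
      ring

end CubicPencil

section CubicCharacterSum

variable {F : Type*} [Field F] [Fintype F] {ψ : AddChar F ℂ}

/-- The exponential sum of `a x ^ 3 + b x`, as a real number. -/
noncomputable def cubicSum (ψ : AddChar F ℂ) (a b : F) : ℝ :=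
  (∑ t, ψ (a * t ^ 3 + b * t)).re

theorem coe_cubicSum (ψ : AddChar F ℂ) (a b : F) :
    (cubicSum ψ a b : ℂ) = ∑ t, ψ (a * t ^ 3 + b * t) := by
  refine Complex.conj_eq_iff_re.mp ?_
  rw [map_sum, ← Equiv.sum_comp (Equiv.neg F)]
  refine Finset.sum_congr rfl fun t _ => ?_
  rw [← AddChar.map_neg_eq_conj]
  congr 1
  simp only [Equiv.neg_apply]
  ring

theorem cubicSum_zero_zero (ψ : AddChar F ℂ) : cubicSum ψ 0 0 = Fintype.card F := by
  simp [cubicSum]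

theorem cubicSum_zero_left (hψ : ψ ≠ 1) {b : F} (hb : b ≠ 0) : cubicSum ψ 0 b = 0 := by
  have h : ∑ t, ψ (b * t) = ∑ t, ψ t := Equiv.sum_comp (Equiv.mulLeft₀ b hb) ψ
  simp [cubicSum, h, AddChar.sum_eq_zero_of_ne_one hψ]

theorem cubicSum_zero_right (hψ : ψ ≠ 1) (hcube : Function.Bijective fun x : F => x ^ 3) {a : F}
    (ha : a ≠ 0) : cubicSum ψ a 0 = 0 := by
  have h : ∑ t, ψ (a * t ^ 3) = ∑ t, ψ (a * t) := hcube.sum_comp fun t => ψ (a * t)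
  have h' : ∑ t, ψ (a * t) = ∑ t, ψ t := Equiv.sum_comp (Equiv.mulLeft₀ a ha) ψ
  simp [cubicSum, h, h', AddChar.sum_eq_zero_of_ne_one hψ]

theorem cubicSum_scale (ψ : AddChar F ℂ) (a b : F) {u : F} (hu : u ≠ 0) :
    cubicSum ψ (a * u ^ 3) (b * u) = cubicSum ψ a b := by
  rw [cubicSum, cubicSum]
  conv_rhs => rw [← Equiv.sum_comp (Equiv.mulLeft₀ u hu)]
  congr 1
  refine Finset.sum_congr rfl fun t _ => ?_
  congr 1
  simp only [Equiv.mulLeft₀_apply]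
  ring

theorem sum_cubicSum (hψ : ψ ≠ 1) (a : F) : ∑ b, cubicSum ψ a b = Fintype.card F := by
  classical
  have h : ∑ b, ∑ t, ψ (a * t ^ 3 + b * t) = Fintype.card F := by
    rw [Finset.sum_comm, Finset.sum_eq_single 0]
    · simp
    · intro t _ ht
      simp only [AddChar.map_add_eq_mul, ← Finset.mul_sum]
      have h : ∑ b, ψ (b * t) = ∑ b, ψ b := Equiv.sum_comp (Equiv.mulRight₀ t ht) ψ
      rw [h, AddChar.sum_eq_zero_of_ne_one hψ, mul_zero]
    · simp
  simp only [← coe_cubicSum] at h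
  exact_mod_cast h

theorem nonneg_of_cubicSum_le (hψ : ψ ≠ 1) (hcube : Function.Bijective fun x : F => x ^ 3) {M : ℝ}
    (hM : ∀ a b, a ≠ 0 → b ≠ 0 → cubicSum ψ a b ≤ M) : 0 ≤ M := by
  by_contra! hlt
  have h : ∑ b, cubicSum ψ 1 b ≤ 0 := by
    refine Finset.sum_nonpos fun b _ => ?_
    by_cases hb : b = 0
    · rw [hb, cubicSum_zero_right hψ hcube one_ne_zero]
    · exact (hM 1 b one_ne_zero hb).trans hlt.le
  rw [sum_cubicSum hψ] at h
  have : (0 : ℝ) < Fintype.card F := by exact_mod_cast Fintype.card_pos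
  linarith

theorem bijective_cube_of_card_mod_three (hF : Fintype.card F % 3 = 2) :
    Function.Bijective fun x : F => x ^ 3 := by
  refine Finite.injective_iff_bijective.mp fun x y hxy => ?_
  have h : ∀ z : F, z = (z ^ 3) ^ (2 * (Fintype.card F / 3) + 1) := by
    intro z
    rw [← pow_mul]
    have e : 3 * (2 * (Fintype.card F / 3) + 1) = Fintype.card F + (Fintype.card F - 1) := by omega
    rw [e, pow_add, FiniteField.pow_card, ← pow_succ', Nat.sub_add_cancel Fintype.card_pos,
      FiniteField.pow_card]
  rw [h x, h y]
  exact congrArg (· ^ (2 * (Fintype.card F / 3) + 1)) hxy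

end CubicCharacterSum

theorem secondLargestEig_eq {V : Type} [Fintype V] [DecidableEq V] {A : Matrix V V ℝ}
    (hA : A.IsHermitian) {lam : V → ℝ}
    (h : Finset.univ.val.map hA.eigenvalues = Finset.univ.val.map lam) {v w : V} (hvw : w ≠ v)
    (hle : ∀ x, x ≠ v → lam x ≤ lam w) (hwv : lam w ≤ lam v) :
    secondLargestEig hA = lam w := by
  have hw : w ∈ (Finset.univ : Finset V).val.erase v :=
    (Multiset.mem_erase_of_ne hvw).mpr (Finset.mem_univ w)
  have huniv : (Finset.univ : Finset V).val =
      v ::ₘ w ::ₘ ((Finset.univ : Finset V).val.erase v).erase w := by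
    rw [Multiset.cons_erase hw, Multiset.cons_erase (Finset.mem_univ v)]
  have hmap := congrArg (Multiset.map lam) huniv
  rw [Multiset.map_cons, Multiset.map_cons] at hmap
  have hcard : Fintype.card V = Multiset.card (Finset.univ.val.map lam) := by simp
  rw [secondLargestEig, eigSorted, h, hcard, hmap]
  refine Multiset.sort_cons_cons_getD hwv fun x hx => ?_
  obtain ⟨y, hy, rfl⟩ := Multiset.mem_map.mp hx
  refine hle y ?_
  have hy' := Multiset.mem_of_mem_erase hy
  exact ((Multiset.Nodup.mem_erase_iff Finset.univ.nodup).mp hy').1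

/-- The exponential sums are sums of a nontrivial additive character. -/
theorem exists_addChar_expSum {p : ℕ} [Fact p.Prime] (F : Type) [Field F] [Fintype F]
    [Algebra (ZMod p) F] :
    ∃ ψ : AddChar F ℂ, ψ ≠ 1 ∧ ∀ f : Polynomial F, expSum p F f = ∑ x, ψ (f.eval x) := by
  have hp0 : p ≠ 0 := (Fact.out : p.Prime).ne_zero
  have hζ := Complex.isPrimitiveRoot_exp p hp0
  let ψ₀ : AddChar (ZMod p) ℂ := AddChar.zmodChar p hζ.pow_eq_one
  let ψ : AddChar F ℂ := ψ₀.compAddMonoidHom (Algebra.trace (ZMod p) F).toAddMonoidHom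
  have hψ : ∀ x, ψ x = Complex.exp (2 * Real.pi * Complex.I / p) ^
      (Algebra.trace (ZMod p) F x).val := fun x => AddChar.zmodChar_apply hζ.pow_eq_one _
  refine ⟨ψ, ?_, fun f => ?_⟩
  · obtain ⟨x, hx⟩ := Algebra.trace_surjective (ZMod p) F 1
    refine AddChar.ne_one_iff.mpr ⟨x, ?_⟩
    have : Fact (1 < p) := ⟨(Fact.out : p.Prime).one_lt⟩
    rw [hψ, hx, ZMod.val_one, pow_one]
    exact hζ.ne_one (Fact.out : p.Prime).one_lt
  · simp only [hψ, expSum]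

section ConnectionSet

variable {F : Type*} [Field F] {n : ℕ}

/-- The difference of two adjacent vertices, with first coordinate `t` and slope `u`. -/
def connectionVector (n : ℕ) (z : F × F) : Fin (n + 2) → F :=
  Fin.cons z.1 (Fin.cons (z.1 * z.2) fun j : Fin n => z.1 ^ 3 * z.2 ^ (j + 2 : ℕ))

/-- The polynomial formed by the coordinates of index at least two. -/
noncomputable def tailPolynomial (w : Fin (n + 2) → F) : Polynomial F :=
  ∑ j : Fin n, Polynomial.C (w j.succ.succ) * Polynomial.X ^ (j : ℕ)

theorem connectionVector_dotProduct (t u : F) (w : Fin (n + 2) → F) :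
    connectionVector n (t, u) ⬝ᵥ w =
      (u ^ 2 * (tailPolynomial w).eval u) * t ^ 3 + (w 0 + w 1 * u) * t := by
  rw [dotProduct, Fin.sum_univ_succ, Fin.sum_univ_succ, tailPolynomial, Polynomial.eval_finsetSum,
    Finset.mul_sum, Finset.sum_mul]
  have : ∀ j : Fin n, connectionVector n (t, u) j.succ.succ * w j.succ.succ =
      u ^ 2 * (Polynomial.C (w j.succ.succ) * Polynomial.X ^ (j : ℕ)).eval u * t ^ 3 := by
    intro j
    simp only [connectionVector, Fin.cons_succ, Polynomial.eval_mul, Polynomial.eval_C,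
      Polynomial.eval_pow, Polynomial.eval_X]
    ring
  have e0 : connectionVector n (t, u) 0 = t := rfl
  have e1 : connectionVector n (t, u) (Fin.succ 0) = t * u := rfl
  rw [Finset.sum_congr rfl fun j _ => this j, e0, e1, Fin.succ_zero_eq_one, ← add_assoc, add_comm]
  congr 1
  ring

theorem natDegree_tailPolynomial_lt (hn : 0 < n) (w : Fin (n + 2) → F) :
    (tailPolynomial w).natDegree < n := by
  refine lt_of_le_of_lt (Polynomial.natDegree_sum_le_of_forall_le (n := n - 1) _ _ fun j _ => ?_)
    (Nat.sub_lt hn one_pos)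
  refine (Polynomial.natDegree_C_mul_X_pow_le _ _).trans ?_
  omega

theorem coeff_tailPolynomial (w : Fin (n + 2) → F) (j : Fin n) :
    (tailPolynomial w).coeff j = w j.succ.succ := by
  rw [tailPolynomial, Polynomial.finsetSum_coeff, Finset.sum_eq_single j]
  · simp
  · intro i _ hij
    rw [Polynomial.coeff_C_mul_X_pow, if_neg]
    exact fun h => hij (Fin.ext h.symm)
  · simp

theorem tailPolynomial_cons_cons {P : Polynomial F} (hP : P.natDegree < n) (l₀ l₁ : F) :
    tailPolynomial (Fin.cons l₀ (Fin.cons l₁ fun j : Fin n => P.coeff j) : Fin (n + 2) → F) =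
      P := by
  simp only [tailPolynomial, Fin.cons_succ]
  rw [Fin.sum_univ_eq_sum_range fun j => Polynomial.C (P.coeff j) * Polynomial.X ^ j]
  exact (P.as_sum_range_C_mul_X_pow' hP).symm

theorem eq_zero_of_tailPolynomial_eq_zero {w : Fin (n + 2) → F} (h : tailPolynomial w = 0)
    (h0 : w 0 = 0) (h1 : w 1 = 0) : w = 0 := by
  ext i
  refine Fin.cases h0 (fun i => Fin.cases h1 (fun j => ?_) i) i
  have hj := coeff_tailPolynomial w j
  rw [h, Polynomial.coeff_zero] at hj
  exact hj.symm

variable [Fintype F] [DecidableEq F]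

/-- The connection set of the Cayley graph. -/
def connectionSet (F : Type*) [Field F] [Fintype F] [DecidableEq F] (n : ℕ) :
    Finset (Fin (n + 2) → F) :=
  ((Finset.univ.erase 0) ×ˢ Finset.univ).image (connectionVector n)

theorem mem_connectionSet {v : Fin (n + 2) → F} :
    v ∈ connectionSet F n ↔
      v 0 ≠ 0 ∧ ∀ i : Fin (n + 2), 2 ≤ (i : ℕ) → v i = v 0 ^ 3 * (v 1 / v 0) ^ (i : ℕ) := by
  simp only [connectionSet, Finset.mem_image, Finset.mem_product, Finset.mem_erase,
    Finset.mem_univ, and_true, Prod.exists]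
  constructor
  · rintro ⟨t, u, ht, rfl⟩
    have e1 : connectionVector n (t, u) 1 = t * u := rfl
    have e0 : connectionVector n (t, u) 0 = t := rfl
    rw [e0, e1, mul_div_cancel_left₀ u ht]
    refine ⟨ht, fun i => ?_⟩
    refine Fin.cases (fun h => by simp at h) (fun i => Fin.cases (fun h => by simp at h)
      (fun j _ => ?_) i) i
    simp [connectionVector]
  · rintro ⟨h0, hi⟩
    refine ⟨v 0, v 1 / v 0, h0, funext fun i => ?_⟩
    refine Fin.cases rfl (fun i => Fin.cases ?_ (fun j => ?_) i) i
    · simp [connectionVector, mul_div_cancel₀ _ h0]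
    · rw [hi j.succ.succ (by simp)]
      simp [connectionVector]

/-- The eigenvalues of the Cayley graph as sums of cubic exponential sums. -/
theorem sum_connectionSet (ψ : AddChar F ℂ) (w : Fin (n + 2) → F) :
    ∑ c ∈ connectionSet F n, ψ (c ⬝ᵥ w) =
      ((∑ u, cubicSum ψ (u ^ 2 * (tailPolynomial w).eval u) (w 0 + w 1 * u) -
        Fintype.card F : ℝ) : ℂ) := by
  rw [connectionSet, Finset.sum_image, Finset.sum_product_right]
  · push_cast
    simp only [coe_cubicSum]
    rw [eq_sub_iff_add_eq, ← Finset.card_univ, Finset.cast_card, ← Finset.sum_add_distrib]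
    refine Finset.sum_congr rfl fun u _ => ?_
    rw [← Finset.sum_erase_add _ _ (Finset.mem_univ (0 : F))]
    simp [connectionVector_dotProduct]
  · rintro ⟨t, u⟩ hz ⟨t', u'⟩ _ h
    have ht : t = t' := congrFun h 0
    have hu : t * u = t' * u' := congrFun h 1
    subst ht
    have ht0 : t ≠ 0 := by
      have := Finset.mem_coe.mp hz
      simpa using this
    rw [mul_left_cancel₀ ht0 hu]

end ConnectionSet

/-- for odd `q ≡ 2 (mod 3)`, `4 ≤ k ≤ q+1`, `g_i(X) = X³`, `f_i(X) = X^{i−1}`,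
the graph `S(k,q)` is connected and `λ₂(S(k,q)) = max{q(k−3), (q−1)M_q}`, with `M_q ≤ 2√q`. -/
theorem stmt_11 (p e q k : ℕ) (hp : p.Prime) (he : 1 ≤ e) (hq : q = p ^ e)
    (hqodd : Odd q) (hq3 : q % 3 = 2) (hk4 : 4 ≤ k) (hkq : k ≤ q + 1)
    (F : Type) [Field F] [Fintype F] [DecidableEq F] [Algebra (ZMod p) F]
    (hcard : Fintype.card F = q)
    (f g : Fin k → Polynomial F)
    (hf : ∀ i : Fin k, 2 ≤ (i : ℕ) → f i = Polynomial.X ^ (i : ℕ))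
    (hg : ∀ i : Fin k, 2 ≤ (i : ℕ) → g i = Polynomial.X ^ 3)
    (G : SimpleGraph (Fin k → F)) [DecidableRel G.Adj]
    (hAdj : ∀ a b : Fin k → F, G.Adj a b ↔
      (a ⟨0, by omega⟩ ≠ b ⟨0, by omega⟩ ∧ ∀ i : Fin k, 2 ≤ (i : ℕ) →
        b i - a i = (g i).eval (b ⟨0, by omega⟩ - a ⟨0, by omega⟩) *
          (f i).eval ((b ⟨1, by omega⟩ - a ⟨1, by omega⟩) / (b ⟨0, by omega⟩ - a ⟨0, by omega⟩))))
    (hA : (G.adjMatrix ℝ).IsHermitian)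
    (Mq : ℝ)
    (hMq : IsGreatest {r : ℝ | ∃ a b : F, a ≠ 0 ∧ b ≠ 0 ∧
      expSum p F (Polynomial.C a * Polynomial.X ^ 3 + Polynomial.C b * Polynomial.X) = (r : ℂ)}
      Mq) :
    G.Connected ∧
      secondLargestEig hA = max ((q : ℝ) * ((k : ℝ) - 3)) (((q : ℝ) - 1) * Mq) ∧
      Mq ≤ 2 * Real.sqrt q := by
  obtain ⟨n, rfl⟩ : ∃ n, k = n + 2 := ⟨k - 2, by omega⟩
  have : Fact p.Prime := ⟨hp⟩
  have : CharP F p := charP_of_injective_algebraMap (algebraMap (ZMod p) F).injective p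
  obtain ⟨ψ, hψ, hexp⟩ := exists_addChar_expSum (p := p) F
  have hcube : Function.Bijective fun x : F => x ^ 3 :=
    bijective_cube_of_card_mod_three (by rw [hcard, hq3])
  have hq5 : 5 ≤ q := by
    obtain ⟨j, rfl⟩ := hqodd
    omega
  have hmem : ∀ (a b : F) (r : ℝ), expSum p F (Polynomial.C a * Polynomial.X ^ 3 +
      Polynomial.C b * Polynomial.X) = (r : ℂ) ↔ cubicSum ψ a b = r := by
    intro a b r
    rw [hexp, ← Complex.ofReal_inj, coe_cubicSum]
    simp
  have hM : ∀ a b : F, a ≠ 0 → b ≠ 0 → cubicSum ψ a b ≤ Mq := fun a b ha hb =>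
    hMq.2 ⟨a, b, ha, hb, (hmem a b _).mpr rfl⟩
  have hMex : ∃ a b : F, a ≠ 0 ∧ b ≠ 0 ∧ cubicSum ψ a b = Mq := by
    obtain ⟨a, b, ha, hb, h⟩ := hMq.1
    exact ⟨a, b, ha, hb, (hmem a b _).mp h⟩
  have hM0 : 0 ≤ Mq := nonneg_of_cubicSum_le hψ hcube hM
  have hpdvd : ∀ m : ℕ, m.Prime → (m : F) = 0 → m ∣ q := by
    intro m hm h
    rw [CharP.cast_eq_zero_iff F p, Nat.prime_dvd_prime_iff_eq hp hm] at h
    rw [hq, h]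
    exact dvd_pow_self m (by omega)
  have h2 : (2 : F) ≠ 0 := by
    intro h
    have := hpdvd 2 Nat.prime_two (by exact_mod_cast h)
    obtain ⟨j, rfl⟩ := hqodd
    omega
  have h3 : (3 : F) ≠ 0 := by
    intro h
    have := hpdvd 3 Nat.prime_three (by exact_mod_cast h)
    omega
  have hcop : Nat.Coprime q 3 :=
    ((Nat.Prime.coprime_iff_not_dvd Nat.prime_three).mpr (by omega)).symm
  have hWeil : Mq ≤ 2 * Real.sqrt q := by
    obtain ⟨a, b, ha, hb, rfl⟩ := hMex
    obtain ⟨s, hs⟩ := hcube.2 a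
    have hs0 : s ≠ 0 := by
      rintro rfl
      exact ha (by simpa using hs.symm)
    have h := cubicSum_scale ψ 1 (b / s) hs0
    have hs' : 1 * s ^ 3 = a := by simpa using hs
    rw [hs', div_mul_cancel₀ b hs0] at h
    rw [h, cubicSum]
    refine (Complex.re_le_norm _).trans ?_
    simpa using norm_sum_addChar_cubic_le_two_mul_sqrt_s11 hq hcard h2 h3 hcop (b / s) hψ
  have hqR : (5 : ℝ) ≤ q := by exact_mod_cast hq5
  have hMlt : Mq < q := by
    refine hWeil.trans_lt ?_
    have h1 : √(q : ℝ) ^ 2 = q := Real.sq_sqrt (by linarith)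
    have h4 : 2 < √(q : ℝ) := Real.lt_sqrt_of_sq_lt (by linarith)
    nlinarith
  have hG : ∀ a b, G.Adj a b ↔ b - a ∈ connectionSet F n := by
    intro a b
    rw [hAdj, mem_connectionSet]
    refine and_congr ?_ (forall_congr' fun i => imp_congr_right fun hi => ?_)
    · rw [Pi.sub_apply, sub_ne_zero]
      exact ne_comm
    · rw [hf i hi, hg i hi, Polynomial.eval_pow, Polynomial.eval_pow, Polynomial.eval_X,
        Polynomial.eval_X]
      rfl
  let lam : (Fin (n + 2) → F) → ℝ := fun w =>
    ∑ u, cubicSum ψ (u ^ 2 * (tailPolynomial w).eval u) (w 0 + w 1 * u) - q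
  have hlam : ∀ w, ∑ c ∈ connectionSet F n, ψ (c ⬝ᵥ w) = lam w := by
    intro w
    rw [sum_connectionSet, hcard]
  have h00 : cubicSum ψ 0 0 = q := by rw [cubicSum_zero_zero, hcard]
  have hε0 : ∀ b, b ≠ 0 → cubicSum ψ 0 b = 0 := fun b hb => cubicSum_zero_left hψ hb
  have hε1 : ∀ a, a ≠ 0 → cubicSum ψ a 0 = 0 := fun a ha => cubicSum_zero_right hψ hcube ha
  have hlam0 : lam 0 = q * q - q := by
    simp [lam, tailPolynomial, h00, hcard]
  set μ : ℝ := max (q * ((n : ℝ) - 1)) ((q - 1) * Mq) with hμ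
  have hle : ∀ w, w ≠ 0 → lam w ≤ μ := by
    intro w hw
    refine sum_cubicPencil_le hcard h00 hε0 hε1 hM hM0
      (natDegree_tailPolynomial_lt (by omega) w) fun h => hw ?_
    exact eq_zero_of_tailPolynomial_eq_zero h.1 h.2.1 h.2.2
  have hμlt : μ < lam 0 := by
    rw [hlam0]
    have hnq : (n : ℝ) + 1 ≤ q := by exact_mod_cast (by omega : n + 1 ≤ q)
    refine max_lt ?_ ?_ <;> nlinarith
  obtain ⟨w, hw, hwμ⟩ : ∃ w, w ≠ 0 ∧ lam w = μ := by
    obtain ⟨P, l₀, l₁, hP, hne, heq⟩ := exists_sum_cubicPencil_eq hcard h00 hε1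
      (fun a b u hu => cubicSum_scale ψ a b hu) hMex (n := n) (by omega) (by omega)
    refine ⟨Fin.cons l₀ (Fin.cons l₁ fun j : Fin n => P.coeff j), fun h => hne ⟨?_, ?_, ?_⟩, ?_⟩
    · rw [← tailPolynomial_cons_cons hP l₀ l₁, h]
      simp [tailPolynomial]
    · exact congrFun h 0
    · exact congrFun h 1
    · simp only [lam, tailPolynomial_cons_cons hP]
      exact heq
  have hdeg : ((connectionSet F n).card : ℝ) = lam 0 := by
    have h := hlam 0
    simp only [dotProduct_zero, AddChar.map_zero_eq_one, Finset.sum_const, nsmul_eq_mul,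
      mul_one] at h
    exact_mod_cast h
  refine ⟨connected_cayley hψ hG hlam fun v hv => ?_, ?_, hWeil⟩
  · rw [hdeg]
    exact ((hle v hv).trans_lt hμlt).ne
  · rw [secondLargestEig_eq hA (map_eigenvalues_cayley hψ hG hlam hA) hw
      (fun x hx => (hle x hx).trans_eq hwμ.symm) (hwμ.trans_le hμlt.le), hwμ, hμ]
    congr 2
    push_cast
    ring
end
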